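/- Let P_1(d),...,P_ℓ(d) be polynomials with integer coefficients satisfying P_i(0)=0 for i=1,...,ℓ, and let k = max_i deg P_i ≥ 2. There exists a constant C' > 0, depending only on P_1,...,P_ℓ, such that for every integer N ≥ 3 and all sets A, B ⊆ {1,...,N} with the property that for every nonzero integer d and every integer m with 2 ≤ m ≤ 2N the set m + {P_1(d),...,P_ℓ(d)} is NOT contained in the sumset A + B = {a + b : a ∈ A, b ∈ B}, one has |A||B|/N² ≤ C' · (log log N / log N)^{1/(ℓ(k−1))}. -/

import Mathlib

open Finset Pointwise

/-- The additive character `x ↦ exp (2πix)` of the real line. -/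
noncomputable def unitExp (x : ℝ) : ℂ := Complex.exp (Complex.I * ((2 * Real.pi * x : ℝ) : ℂ))

lemma unitExp_add (x y : ℝ) : unitExp (x + y) = unitExp x * unitExp y := by
  unfold unitExp
  rw [← Complex.exp_add]
  congr 1
  push_cast
  ring

lemma unitExp_zero : unitExp 0 = 1 := by simp [unitExp]

lemma norm_unitExp (x : ℝ) : ‖unitExp x‖ = 1 := by
  unfold unitExp
  rw [mul_comm]
  exact Complex.norm_exp_ofReal_mul_I _

lemma unitExp_neg (x : ℝ) : unitExp (-x) = starRingEnd ℂ (unitExp x) := by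
  unfold unitExp
  rw [← Complex.exp_conj, map_mul, Complex.conj_I, Complex.conj_ofReal]
  congr 1
  push_cast
  ring

lemma unitExp_sub (x y : ℝ) : unitExp (x - y) = unitExp x * starRingEnd ℂ (unitExp y) := by
  rw [sub_eq_add_neg, unitExp_add, unitExp_neg]

lemma unitExp_int (n : ℤ) : unitExp n = 1 := by
  unfold unitExp
  rw [Complex.exp_eq_one_iff]
  exact ⟨n, by push_cast; ring⟩

lemma unitExp_add_int (x : ℝ) (n : ℤ) : unitExp (x + n) = unitExp x := by
  rw [unitExp_add, unitExp_int, mul_one]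

lemma unitExp_nat_mul (n : ℕ) (x : ℝ) : unitExp (n * x) = unitExp x ^ n := by
  unfold unitExp
  rw [← Complex.exp_nat_mul]
  congr 1
  push_cast
  ring

lemma unitExp_sum {ι : Type*} (s : Finset ι) (f : ι → ℝ) :
    unitExp (∑ i ∈ s, f i) = ∏ i ∈ s, unitExp (f i) := by
  classical
  induction s using Finset.induction_on with
  | empty => simp [unitExp_zero]
  | insert a s ha ih => rw [sum_insert ha, prod_insert ha, unitExp_add, ih]

lemma norm_unitExp_sub_one_le (x : ℝ) : ‖unitExp x - 1‖ ≤ 7 * |x| := by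
  have h := Real.norm_exp_I_mul_ofReal_sub_one_le (x := 2 * Real.pi * x)
  rw [Real.norm_eq_abs, abs_mul, abs_of_pos (by positivity : 0 < 2 * Real.pi)] at h
  refine h.trans ?_
  have := Real.pi_lt_d2
  gcongr
  linarith

/-- `x` is within `t` of an integer. -/
def NearInt (x t : ℝ) : Prop := ∃ z : ℤ, |x - z| ≤ t

namespace NearInt

lemma mono {x t u : ℝ} (h : NearInt x t) (htu : t ≤ u) : NearInt x u :=
  let ⟨z, hz⟩ := h
  ⟨z, hz.trans htu⟩

lemma nonneg {x t : ℝ} (h : NearInt x t) : 0 ≤ t :=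
  let ⟨_, hz⟩ := h
  (abs_nonneg _).trans hz

lemma of_half_le (x : ℝ) {t : ℝ} (ht : 1 / 2 ≤ t) : NearInt x t :=
  ⟨round x, (abs_sub_round x).trans ht⟩

lemma add {x y t u : ℝ} (hx : NearInt x t) (hy : NearInt y u) : NearInt (x + y) (t + u) := by
  obtain ⟨z, hz⟩ := hx
  obtain ⟨w, hw⟩ := hy
  refine ⟨z + w, ?_⟩
  push_cast
  calc |x + y - (z + w)| = |(x - z) + (y - w)| := by ring_nf
    _ ≤ _ := (abs_add_le _ _).trans (add_le_add hz hw)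

lemma int_mul {x t : ℝ} (h : NearInt x t) (n : ℤ) : NearInt (n * x) (|(n : ℝ)| * t) := by
  obtain ⟨z, hz⟩ := h
  refine ⟨n * z, ?_⟩
  push_cast
  rw [← mul_sub, abs_mul]
  gcongr

lemma nat_mul {x t : ℝ} (h : NearInt x t) (n : ℕ) : NearInt (n * x) (n * t) := by
  simpa using h.int_mul n

lemma neg {x t : ℝ} (h : NearInt x t) : NearInt (-x) t := by
  simpa using h.int_mul (-1)

lemma sub {x y t u : ℝ} (hx : NearInt x t) (hy : NearInt y u) : NearInt (x - y) (t + u) := by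
  rw [sub_eq_add_neg]
  exact hx.add hy.neg

lemma sum {ι : Type*} (s : Finset ι) {f g : ι → ℝ} (h : ∀ i ∈ s, NearInt (f i) (g i)) :
    NearInt (∑ i ∈ s, f i) (∑ i ∈ s, g i) := by
  classical
  induction s using Finset.induction_on with
  | empty => exact ⟨0, by simp⟩
  | insert a s ha ih =>
    rw [sum_insert ha, sum_insert ha]
    exact (h a (mem_insert_self a s)).add (ih fun i hi => h i (mem_insert_of_mem hi))

lemma norm_unitExp_sub_one_le {x t : ℝ} (h : NearInt x t) : ‖unitExp x - 1‖ ≤ 7 * t := by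
  obtain ⟨z, hz⟩ := h
  have h1 : unitExp x = unitExp (x - z) := by
    rw [← unitExp_add_int (x - z) z]
    congr 1
    ring
  rw [h1]
  exact (_root_.norm_unitExp_sub_one_le _).trans (by gcongr)

end NearInt

lemma nearInt_norm_unitExp_sub_one (x : ℝ) : NearInt x (‖unitExp x - 1‖ / 4) := by
  refine ⟨round x, ?_⟩
  set t := x - round x with ht
  have h1 : unitExp x = unitExp t := by
    rw [← unitExp_add_int t (round x)]
    congr 1
    rw [ht]
    ring
  have h2 : |t| ≤ 1 / 2 := abs_sub_round x
  have h3 : ‖unitExp t - 1‖ = ‖2 * Real.sin (2 * Real.pi * t / 2)‖ :=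
    Complex.norm_exp_I_mul_ofReal_sub_one _
  have hpi := Real.pi_pos
  have h4 : 2 * |t| ≤ |Real.sin (Real.pi * t)| := by
    have h5 : 2 / Real.pi * (Real.pi * |t|) ≤ Real.sin (Real.pi * |t|) :=
      Real.mul_le_sin (by positivity) (by nlinarith)
    have h6 : 2 / Real.pi * (Real.pi * |t|) = 2 * |t| := by field_simp
    rw [h6] at h5
    refine h5.trans ?_
    rcases abs_cases t with ⟨h, _⟩ | ⟨h, _⟩ <;> rw [h]
    · exact le_abs_self _
    · rw [mul_neg, Real.sin_neg]
      exact neg_le_abs _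
  rw [h1, h3, Real.norm_eq_abs, abs_mul, abs_two]
  have h7 : 2 * Real.pi * t / 2 = Real.pi * t := by ring
  rw [h7]
  linarith

lemma norm_sum_unitExp_linear_mul_le (c b : ℝ) (J : ℕ) :
    ‖∑ j ∈ range J, unitExp (b + j * c)‖ * ‖unitExp c - 1‖ ≤ 2 := by
  have h : ∑ j ∈ range J, unitExp (b + j * c) = unitExp b * ∑ j ∈ range J, unitExp c ^ j := by
    rw [mul_sum]
    exact sum_congr rfl fun j _ => by rw [unitExp_add, unitExp_nat_mul]
  rw [h, norm_mul, norm_unitExp, one_mul, ← norm_mul, geom_sum_mul]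
  refine (norm_sub_le _ _).trans ?_
  rw [norm_pow, norm_unitExp]
  norm_num

set_option maxHeartbeats 1000000 in
/-- A real number with many near-integral multiples is close to a rational with small
denominator. -/
lemma exists_nearInt_mul_of_many {α τ : ℝ} {D R : ℕ} (H : Finset ℕ) (hH : H ⊆ range D)
    (hcard : D ≤ R * #H) (hD : 2 * R < D) (hτ : 64 * R * τ ≤ 1)
    (hnear : ∀ h ∈ H, NearInt (α * h) τ) :
    ∃ q : ℕ, 1 ≤ q ∧ q ≤ 2 * R ∧ NearInt (q * α) (16 * R ^ 2 * τ / D) := by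
  have hR : 0 < R := by
    rcases Nat.eq_zero_or_pos R with rfl | h
    · simp at hcard; omega
    · exact h
  have hRr : (1 : ℝ) ≤ R := by exact_mod_cast hR
  have hDr : (0 : ℝ) < D := by exact_mod_cast (by omega : 0 < D)
  have hcardr : (D : ℝ) ≤ R * #H := by exact_mod_cast hcard
  -- two elements of `H` are close
  obtain ⟨h₁, hh₁, h₂, hh₂, hlt, hclose⟩ : ∃ h₁ ∈ H, ∃ h₂ ∈ H, h₁ < h₂ ∧ h₂ - h₁ ≤ 2 * R := by
    have hmaps : ∀ h ∈ H, h / (2 * R) ∈ range (D / (2 * R) + 1) := by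
      intro h hh
      have := mem_range.1 (hH hh)
      rw [mem_range]
      exact Nat.lt_succ_of_le (Nat.div_le_div_right this.le)
    have hlt : #(range (D / (2 * R) + 1)) < #H := by
      rw [card_range]
      have h1 : D / (2 * R) * (2 * R) ≤ D := Nat.div_mul_le_self _ _
      by_contra hcon
      push Not at hcon
      nlinarith
    obtain ⟨x, hx, y, hy, hne, hxy⟩ := exists_ne_map_eq_of_card_lt_of_maps_to hlt hmaps
    have key : ∀ x y : ℕ, x / (2 * R) = y / (2 * R) → y - x ≤ 2 * R := by
      intro x y hxy
      have h1 := Nat.div_add_mod x (2 * R)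
      have h2 := Nat.div_add_mod y (2 * R)
      have h3 := Nat.mod_lt y (by omega : 0 < 2 * R)
      rw [hxy] at h1
      omega
    rcases lt_or_gt_of_ne hne with h | h
    · exact ⟨x, hx, y, hy, h, key x y hxy⟩
    · exact ⟨y, hy, x, hx, h, key y x hxy.symm⟩
  set q := h₂ - h₁ with hq
  have hq1 : 1 ≤ q := by omega
  have hqr : (q : ℝ) = h₂ - h₁ := by rw [hq, Nat.cast_sub hlt.le]
  refine ⟨q, hq1, hclose, ?_⟩
  obtain ⟨z, hz⟩ : NearInt (q * α) (τ + τ) := by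
    have := (hnear h₂ hh₂).sub (hnear h₁ hh₁)
    rwa [← mul_sub, ← hqr, mul_comm] at this
  refine ⟨z, ?_⟩
  set β := (q : ℝ) * α - z with hβ
  by_contra hcon
  push Not at hcon
  have hτ0 : 0 ≤ τ := (hnear h₁ hh₁).nonneg
  have hβpos : 0 < |β| := lt_of_le_of_lt (by positivity) hcon
  have hτpos : 0 < τ := by linarith
  have hqpos : (0 : ℝ) < q := by exact_mod_cast hq1
  have hτs : τ ≤ 1 / 64 := by nlinarith
  -- block length
  set B := ⌊1 / (2 * |β|)⌋₊ with hB
  have hB1 : (B : ℝ) ≤ 1 / (2 * |β|) := Nat.floor_le (by positivity)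
  have hB2 : 1 / (2 * |β|) < B + 1 := Nat.lt_floor_add_one _
  have hβ1 : 1 ≤ 1 / (4 * |β|) := by
    rw [le_div_iff₀ (by positivity)]
    linarith
  have hB3 : 1 / (4 * |β|) ≤ B := by
    have : 1 / (2 * |β|) = 1 / (4 * |β|) + 1 / (4 * |β|) := by field_simp; norm_num
    linarith
  have hBpos : 0 < B := by
    have : (0 : ℝ) < B := by linarith
    exact_mod_cast this
  set n := ⌊2 * τ / |β|⌋₊ + 1 with hn
  have hn1 : (n : ℝ) ≤ 4 * τ / |β| := by
    have h1 : (⌊2 * τ / |β|⌋₊ : ℝ) ≤ 2 * τ / |β| := Nat.floor_le (by positivity)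
    have h2 : 1 ≤ 2 * τ / |β| := by
      rw [le_div_iff₀ hβpos]
      linarith
    have h3 : 4 * τ / |β| = 2 * τ / |β| + 2 * τ / |β| := by ring
    rw [hn]
    push_cast
    linarith
  let f : ℕ → ℕ × ℕ := fun h => (h % q, h / q / B)
  have himg : #(H.image f) ≤ q * (D / q / B + 1) := by
    have hsub : H.image f ⊆ range q ×ˢ range (D / q / B + 1) := by
      intro p hp
      obtain ⟨h, hh, rfl⟩ := mem_image.1 hp
      have := mem_range.1 (hH hh)
      rw [mem_product, mem_range, mem_range]
      exact ⟨Nat.mod_lt _ hq1, Nat.lt_succ_of_le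
        (Nat.div_le_div_right (Nat.div_le_div_right this.le))⟩
    simpa using card_le_card hsub
  have hfib : ∀ a ∈ H.image f, #{x ∈ H | f x = a} ≤ n := by
    intro a _
    rcases ({x ∈ H | f x = a}).eq_empty_or_nonempty with he | hne
    · rw [he]; simp
    set m := ({x ∈ H | f x = a}).min' hne with hm
    have hmmem := ({x ∈ H | f x = a}).min'_mem hne
    rw [← hm, mem_filter] at hmmem
    have hkey : ∀ x ∈ ({x ∈ H | f x = a}), m ≤ x ∧ x = m + q * (x / q - m / q) ∧
        x / q - m / q < n := by
      intro x hx
      have hle : m ≤ x := min'_le _ x hx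
      rw [mem_filter] at hx
      have hfx : f x = f m := hx.2.trans hmmem.2.symm
      simp only [f, Prod.mk.injEq] at hfx
      have hdm := Nat.div_le_div_right (c := q) hle
      have e1 := Nat.div_add_mod x q
      have e2 := Nat.div_add_mod m q
      have hx' : x = m + q * (x / q - m / q) := by
        rw [Nat.mul_sub]
        have := Nat.mul_le_mul_left q hdm
        omega
      refine ⟨hle, hx', ?_⟩
      set j := x / q - m / q with hj
      have hjB : j < B := by
        have g1 := Nat.div_add_mod (x / q) B
        have g2 := Nat.div_add_mod (m / q) B
        have g3 := Nat.mod_lt (x / q) hBpos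
        rw [hfx.2] at g1
        omega
      -- `jβ` is near an integer and small, hence tiny
      obtain ⟨w, hw⟩ : NearInt ((j : ℝ) * β) (τ + τ) := by
        have h1 := (hnear x hx.1).sub (hnear m hmmem.1)
        obtain ⟨w, hw⟩ := h1
        refine ⟨w - j * z, ?_⟩
        have hxr : (x : ℝ) = m + q * j := by exact_mod_cast hx'
        have : (j : ℝ) * β - ((w - j * z : ℤ) : ℝ) = α * x - α * m - w := by
          rw [hxr, hβ]
          push_cast
          ring
        rw [this]
        exact hw
      have hjβ : |(j : ℝ) * β| ≤ 1 / 2 := by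
        rw [abs_mul, abs_of_nonneg (by positivity : (0 : ℝ) ≤ j)]
        have hjr : (j : ℝ) ≤ 1 / (2 * |β|) := by
          have : (j : ℝ) ≤ B := by exact_mod_cast hjB.le
          linarith
        calc (j : ℝ) * |β| ≤ 1 / (2 * |β|) * |β| := by gcongr
          _ = 1 / 2 := by field_simp
      have hw0 : w = 0 := by
        have : |(w : ℝ)| < 1 := by
          have h1 : (w : ℝ) = (j : ℝ) * β - ((j : ℝ) * β - w) := by ring
          rw [h1]
          refine (abs_sub _ _).trans_lt ?_
          linarith
        have h2 : |w| < 1 := by exact_mod_cast this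
        exact Int.abs_lt_one_iff.1 h2
      rw [hw0, Int.cast_zero, sub_zero, abs_mul, abs_of_nonneg (by positivity : (0 : ℝ) ≤ j)] at hw
      rw [hn, Nat.lt_succ_iff]
      apply Nat.le_floor
      rw [le_div_iff₀ hβpos]
      linarith
    have hinj : Set.InjOn (fun x => x / q - m / q) ({x ∈ H | f x = a} : Finset ℕ) := by
      intro x hx y hy hxy
      have h1 := (hkey x hx).2.1
      have h2 := (hkey y hy).2.1
      simp only at hxy
      rw [h1, h2, hxy]
    calc #{x ∈ H | f x = a} = #(({x ∈ H | f x = a}).image fun x => x / q - m / q) :=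
          (card_image_of_injOn hinj).symm
      _ ≤ #(range n) := by
          apply card_le_card
          intro y hy
          obtain ⟨x, hx, rfl⟩ := mem_image.1 hy
          exact mem_range.2 (hkey x hx).2.2
      _ = n := card_range n
  have htot : #H ≤ n * (q * (D / q / B + 1)) :=
    (card_le_mul_card_image H n hfib).trans (Nat.mul_le_mul_left n himg)
  have htotr : (#H : ℝ) ≤ n * (q * ((D / q / B : ℕ) + 1)) := by exact_mod_cast htot
  have hdiv : ((D / q / B : ℕ) : ℝ) ≤ D / q * (4 * |β|) := by
    have h1 : ((D / q / B : ℕ) : ℝ) ≤ (D : ℝ) / q / B := by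
      refine Nat.cast_div_le.trans ?_
      gcongr
      exact Nat.cast_div_le
    refine h1.trans ?_
    rw [div_eq_mul_inv _ (B : ℝ)]
    gcongr
    rw [inv_le_comm₀ (by exact_mod_cast hBpos) (by positivity)]
    simpa using hB3
  have hfin : (#H : ℝ) ≤ 4 * τ / |β| * (q * (D / q * (4 * |β|) + 1)) := by
    refine htotr.trans ?_
    gcongr
  have hfin2 : 4 * τ / |β| * (q * (D / q * (4 * |β|) + 1)) = 16 * τ * D + 4 * τ * q / |β| := by
    field_simp
    ring
  rw [hfin2] at hfin
  have hq2 : (q : ℝ) ≤ 2 * R := by exact_mod_cast hclose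
  have h1 : 4 * τ * q / |β| ≤ 8 * τ * R / |β| := by
    gcongr ?_ / _
    nlinarith
  have h2 : 8 * τ * R / |β| ≤ D / (2 * R) := by
    rw [div_le_div_iff₀ hβpos (by positivity)]
    rw [div_lt_iff₀ hDr] at hcon
    have e1 : 8 * τ * R * (2 * R) = 16 * (R : ℝ) ^ 2 * τ := by ring
    rw [e1, mul_comm]
    linarith
  have h3 : 16 * τ * D ≤ D / (4 * R) := by
    rw [le_div_iff₀ (by positivity)]
    have e1 := mul_le_mul_of_nonneg_right hτ hDr.le
    linarith
  have h4 : (D : ℝ) / R ≤ #H := by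
    rw [div_le_iff₀ (by positivity)]
    linarith
  have h5 : (D : ℝ) / (4 * R) = D / R / 4 := by field_simp
  have h6 : (D : ℝ) / (2 * R) = D / R / 2 := by field_simp
  have h7 : 0 < (D : ℝ) / R := by positivity
  linarith

/-- The polynomial `∑ c r * x ^ r`, of degree at most `k`. -/
noncomputable def polyPhase (k : ℕ) (c : ℕ → ℝ) (x : ℝ) : ℝ := ∑ r ∈ range (k + 1), c r * x ^ r

/-- The coefficients of the polynomial `x ↦ polyPhase (k + 1) c (x + h) - polyPhase (k + 1) c x`. -/
noncomputable def diffCoeff (k : ℕ) (c : ℕ → ℝ) (h : ℝ) (r : ℕ) : ℝ :=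
  ∑ s ∈ Ico (r + 1) (k + 2), s.choose r * c s * h ^ (s - r)

lemma polyPhase_add_sub (k : ℕ) (c : ℕ → ℝ) (x h : ℝ) :
    polyPhase (k + 1) c (x + h) - polyPhase (k + 1) c x = polyPhase k (diffCoeff k c h) x := by
  have h1 : ∀ s, c s * (x + h) ^ s - c s * x ^ s =
      ∑ r ∈ range s, s.choose r * c s * h ^ (s - r) * x ^ r := by
    intro s
    rw [add_pow, sum_range_succ, mul_add, mul_sum]
    simp only [Nat.sub_self, pow_zero, Nat.choose_self, Nat.cast_one, mul_one, add_sub_cancel_right]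
    exact sum_congr rfl fun r _ => by ring
  simp only [polyPhase, diffCoeff, sum_mul]
  rw [← sum_sub_distrib, sum_congr rfl fun s _ => h1 s]
  apply sum_comm'
  intro s r
  simp only [mem_range, mem_Ico]
  omega

lemma norm_sq_sum_range_le (F : ℕ → ℂ) (hF : ∀ x, ‖F x‖ = 1) (D : ℕ) :
    ‖∑ x ∈ range D, F x‖ ^ 2 ≤ D + 2 * ∑ h ∈ range D,
      ‖∑ x ∈ range (D - 1 - h), F (x + (h + 1)) * starRingEnd ℂ (F x)‖ := by
  have key : ∀ D : ℕ, ‖∑ x ∈ range D, F x‖ ^ 2 = D + 2 * (∑ h ∈ range D,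
      ∑ x ∈ range (D - 1 - h), F (x + (h + 1)) * starRingEnd ℂ (F x)).re := by
    intro D
    induction D with
    | zero => simp
    | succ D ih =>
      have h1 : ∑ h ∈ range (D + 1),
          ∑ x ∈ range (D + 1 - 1 - h), F (x + (h + 1)) * starRingEnd ℂ (F x) =
          ∑ h ∈ range D, ∑ x ∈ range (D - 1 - h), F (x + (h + 1)) * starRingEnd ℂ (F x) +
          F D * starRingEnd ℂ (∑ x ∈ range D, F x) := by
        rw [sum_range_succ]
        simp only [Nat.add_sub_cancel, Nat.sub_self, range_zero, sum_empty, add_zero]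
        rw [map_sum, mul_sum, ← sum_range_reflect (fun x => F D * starRingEnd ℂ (F x)),
          ← sum_add_distrib]
        refine sum_congr rfl fun h hh => ?_
        have hh' := mem_range.1 hh
        have e1 : D - h = (D - 1 - h) + 1 := by omega
        rw [e1, sum_range_succ]
        congr 3
        omega
      have h2 : ‖F D‖ ^ 2 = 1 := by rw [hF]; norm_num
      rw [h1, sum_range_succ, Complex.add_re, mul_add]
      have h3 : ∀ z w : ℂ, ‖z + w‖ ^ 2 = ‖z‖ ^ 2 + ‖w‖ ^ 2 + 2 * (w * starRingEnd ℂ z).re := by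
        intro z w
        rw [Complex.sq_norm, Complex.sq_norm, Complex.sq_norm, Complex.normSq_add]
        congr 2
        rw [← Complex.conj_re (w * _), map_mul, Complex.conj_conj, mul_comm]
      rw [h3, ih, h2]
      push_cast
      ring
  rw [key D]
  gcongr
  refine (Complex.re_le_norm _).trans ?_
  exact norm_sum_le _ _

/-- Van der Corput: a large sum has many large correlations. -/
lemma exists_many_large_correlations (F : ℕ → ℂ) (hF : ∀ x, ‖F x‖ = 1) {D Y : ℕ}
    (hD : 4 * Y ^ 2 ≤ D) (hY : 1 ≤ Y) (hS : (D : ℝ) ≤ Y * ‖∑ x ∈ range D, F x‖) :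
    ∃ H ⊆ range D, D ≤ 4 * Y ^ 2 * #H ∧ ∀ h ∈ H, 1 ≤ h ∧
      (D : ℝ) ≤ 8 * Y ^ 2 * ‖∑ x ∈ range (D - h), F (x + h) * starRingEnd ℂ (F x)‖ := by
  classical
  set T : ℕ → ℝ := fun h => ‖∑ x ∈ range (D - 1 - h), F (x + (h + 1)) * starRingEnd ℂ (F x)‖ with hT
  set K := {h ∈ range D | (D : ℝ) ≤ 8 * Y ^ 2 * T h} with hK
  have hYr : (1 : ℝ) ≤ Y := by exact_mod_cast hY
  have hDpos : 0 < D := by nlinarith [pow_pos (show 0 < Y from hY) 2]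
  have hDr : (0 : ℝ) < D := by exact_mod_cast hDpos
  have hDY : 4 * (Y : ℝ) ^ 2 ≤ D := by exact_mod_cast hD
  have hTD : ∀ h, T h ≤ D := by
    intro h
    refine (norm_sum_le _ _).trans ?_
    simp only [norm_mul, RCLike.norm_conj, hF, mul_one, sum_const, card_range, nsmul_eq_mul]
    exact_mod_cast (by omega : D - 1 - h ≤ D)
  have hlast : ∀ h ∈ K, h + 1 < D := by
    intro h hh
    rw [hK, mem_filter] at hh
    by_contra hcon
    have : D - 1 - h = 0 := by omega
    have h2 := hh.2
    simp only [hT, this, range_zero, sum_empty, norm_zero, mul_zero] at h2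
    linarith
  refine ⟨K.image (· + 1), ?_, ?_, ?_⟩
  · intro x hx
    obtain ⟨h, hh, rfl⟩ := mem_image.1 hx
    exact mem_range.2 (hlast h hh)
  · rw [card_image_of_injective _ (add_left_injective 1)]
    have h1 := norm_sq_sum_range_le F hF D
    have h2 : ∑ h ∈ range D, T h ≤ #K * D + D * (D / (8 * Y ^ 2)) := by
      have h3 : ∀ h ∈ range D, T h ≤ (if h ∈ K then (D : ℝ) else 0) + D / (8 * Y ^ 2) := by
        intro h hh
        split_ifs with hk
        · have := hTD h
          have : 0 ≤ (D : ℝ) / (8 * Y ^ 2) := by positivity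
          linarith [hTD h]
        · rw [hK, mem_filter, not_and] at hk
          have := hk hh
          push Not at this
          rw [zero_add, le_div_iff₀ (by positivity)]
          linarith
      refine (sum_le_sum h3).trans ?_
      rw [sum_add_distrib, sum_const, card_range, nsmul_eq_mul, ← sum_filter, sum_const,
        nsmul_eq_mul]
      gcongr
      intro h hh
      exact (mem_filter.1 hh).2
    have h4 : (D : ℝ) ^ 2 ≤ Y ^ 2 * ‖∑ x ∈ range D, F x‖ ^ 2 := by
      rw [← mul_pow]
      exact pow_le_pow_left₀ hDr.le hS 2
    have h5 : (D : ℝ) ^ 2 ≤ Y ^ 2 * (D + 2 * (#K * D + D * (D / (8 * Y ^ 2)))) := by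
      refine h4.trans ?_
      gcongr
      exact h1.trans (by gcongr)
    have h6 : (Y : ℝ) ^ 2 * (D + 2 * (#K * D + D * (D / (8 * Y ^ 2)))) =
        D * (Y ^ 2 + 2 * Y ^ 2 * #K + D / 4) := by
      field_simp
      ring
    rw [h6, sq, mul_le_mul_iff_right₀ hDr] at h5
    have h7 : (D : ℝ) ≤ 4 * Y ^ 2 * #K := by linarith
    exact_mod_cast h7
  · intro x hx
    obtain ⟨h, hh, rfl⟩ := mem_image.1 hx
    refine ⟨by omega, ?_⟩
    have h1 := (mem_filter.1 hh).2
    have e : D - (h + 1) = D - 1 - h := by omega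
    rw [e]
    exact h1

lemma nearInt_of_pow_le {x : ℝ} {D Y b r : ℕ} (hD : 0 < D) (h : D ^ r ≤ Y ^ b) :
    NearInt x ((Y : ℝ) ^ b / (D : ℝ) ^ r) := by
  apply NearInt.of_half_le
  have hDr : (0 : ℝ) < D := by exact_mod_cast hD
  have : (1 : ℝ) ≤ (Y : ℝ) ^ b / (D : ℝ) ^ r := by
    rw [one_le_div (by positivity)]
    exact_mod_cast h
  linarith

lemma two_pow_le_pow {Y : ℕ} (hY : 2 ≤ Y) (n : ℕ) : (2 : ℝ) ^ n ≤ (Y : ℝ) ^ n :=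
  pow_le_pow_left₀ (by norm_num) (by exact_mod_cast hY) n

lemma succ_le_pow {Y : ℕ} (hY : 2 ≤ Y) (n : ℕ) : (n : ℝ) + 1 ≤ (Y : ℝ) ^ n := by
  have h : n + 1 ≤ Y ^ n := (Nat.lt_pow_self hY : n < Y ^ n)
  exact_mod_cast h

lemma choose_le_pow {Y : ℕ} (hY : 2 ≤ Y) {n m : ℕ} (hn : n ≤ m) (r : ℕ) :
    (n.choose r : ℝ) ≤ (Y : ℝ) ^ m := by
  have h : n.choose r ≤ Y ^ m :=
    (Nat.choose_le_two_pow n r).trans ((Nat.pow_le_pow_left hY n).trans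
      (Nat.pow_le_pow_right (by omega) hn))
  exact_mod_cast h

/-- If many difference polynomials have their coefficients close to rationals with a common small
denominator, then so have the coefficients of degree at least two of the original polynomial. -/
lemma exists_denominator_of_diffCoeff (k a j : ℕ) (hj : j ≤ k) : ∃ b : ℕ,
    ∀ (c : ℕ → ℝ) (D Y : ℕ) (H : Finset ℕ) (q : ℕ), 2 ≤ Y → Y ^ b ≤ D → H ⊆ range D →
      D ≤ Y ^ a * #H → 1 ≤ q → q ≤ Y ^ a →
      (∀ h ∈ H, ∀ r, 1 ≤ r → r ≤ k →
        NearInt (q * diffCoeff k c h r) ((Y : ℝ) ^ a / (D : ℝ) ^ r)) →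
      ∃ Q : ℕ, 1 ≤ Q ∧ Q ≤ Y ^ b ∧ ∀ t, k + 1 - j < t → t ≤ k + 1 →
        NearInt (Q * c t) ((Y : ℝ) ^ b / (D : ℝ) ^ t) := by
  induction j with
  | zero =>
    refine ⟨0, fun c D Y H q hY _ _ _ _ _ _ => ⟨1, le_rfl, by simp, ?_⟩⟩
    intro t h1 h2
    omega
  | succ j ih =>
    obtain ⟨b, hb⟩ := ih (by omega)
    refine ⟨4 * a + b + 2 * k + 10, ?_⟩
    intro c D Y H q hY hYD hHD hcard hq1 hqa hnear
    have hY1 : 1 ≤ Y := by omega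
    have hYr : (1 : ℝ) ≤ Y := by exact_mod_cast hY1
    obtain ⟨Q, hQ1, hQb, hQ⟩ := hb c D Y H q hY
      ((Nat.pow_le_pow_right hY1 (by omega)).trans hYD) hHD hcard hq1 hqa hnear
    have hDpos : 0 < D := (pow_pos hY1 _).trans_le hYD
    have hDr : (0 : ℝ) < D := by exact_mod_cast hDpos
    have hqr : (q : ℝ) ≤ (Y : ℝ) ^ a := by exact_mod_cast hqa
    have hQr : (Q : ℝ) ≤ (Y : ℝ) ^ b := by exact_mod_cast hQb
    have hYDr : (Y : ℝ) ^ (4 * a + b + 2 * k + 10) ≤ D := by exact_mod_cast hYD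
    obtain ⟨r, hr⟩ : ∃ r, r = k - j := ⟨_, rfl⟩
    have hr1 : 1 ≤ r := by omega
    have hrk : r ≤ k := by omega
    set E := 2 * k + 3 + a + b with hE
    set τ : ℝ := (Y : ℝ) ^ E / (D : ℝ) ^ r with hτ
    set α : ℝ := q * Q * (r + 1 : ℕ) * c (r + 1) with hα
    have hαnear : ∀ h ∈ H, NearInt (α * h) τ := by
      intro h hh
      have hhD : (h : ℝ) ≤ D := by exact_mod_cast (mem_range.1 (hHD hh)).le
      have h1 : NearInt (Q * (q * diffCoeff k c h r)) (Q * ((Y : ℝ) ^ a / (D : ℝ) ^ r)) :=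
        (hnear h hh r hr1 hrk).nat_mul Q
      have h2 : NearInt (∑ t ∈ Ico (r + 2) (k + 2),
            ((t.choose r * q * h ^ (t - r) : ℕ) : ℝ) * (Q * c t))
          (∑ t ∈ Ico (r + 2) (k + 2),
            ((t.choose r * q * h ^ (t - r) : ℕ) : ℝ) * ((Y : ℝ) ^ b / (D : ℝ) ^ t)) := by
        apply NearInt.sum
        intro t ht
        rw [mem_Ico] at ht
        exact (hQ t (by omega) (by omega)).nat_mul _
      have h3 : α * h = Q * (q * diffCoeff k c h r) - ∑ t ∈ Ico (r + 2) (k + 2),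
            ((t.choose r * q * h ^ (t - r) : ℕ) : ℝ) * (Q * c t) := by
        rw [diffCoeff, sum_eq_sum_Ico_succ_bot (by omega : r + 1 < k + 2), mul_add, mul_add,
          Nat.choose_succ_self_right, add_tsub_cancel_left, pow_one]
        have : (Q : ℝ) * (q * ∑ s ∈ Ico (r + 1 + 1) (k + 2),
            (s.choose r : ℝ) * c s * (h : ℝ) ^ (s - r)) =
            ∑ t ∈ Ico (r + 2) (k + 2),
            ((t.choose r * q * h ^ (t - r) : ℕ) : ℝ) * (Q * c t) := by
          rw [mul_sum, mul_sum]
          refine sum_congr rfl fun t _ => ?_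
          push_cast
          ring
        rw [this, hα]
        ring
      rw [h3]
      refine (h1.sub h2).mono ?_
      have h4 : ∀ t ∈ Ico (r + 2) (k + 2),
          ((t.choose r * q * h ^ (t - r) : ℕ) : ℝ) * ((Y : ℝ) ^ b / (D : ℝ) ^ t) ≤
          (Y : ℝ) ^ (k + 1 + a + b) / (D : ℝ) ^ r := by
        intro t ht
        rw [mem_Ico] at ht
        push_cast
        have h5 : (D : ℝ) ^ t = (D : ℝ) ^ (t - r) * (D : ℝ) ^ r := by
          rw [← pow_add]
          congr 1
          omega
        calc (t.choose r : ℝ) * q * (h : ℝ) ^ (t - r) * ((Y : ℝ) ^ b / (D : ℝ) ^ t)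
            ≤ (Y : ℝ) ^ (k + 1) * (Y : ℝ) ^ a * (D : ℝ) ^ (t - r) *
              ((Y : ℝ) ^ b / (D : ℝ) ^ t) := by
              gcongr
              exact choose_le_pow hY (by omega) r
          _ = (Y : ℝ) ^ (k + 1 + a + b) / (D : ℝ) ^ r := by
              rw [h5]
              field_simp
              ring
      have h6 : ∑ t ∈ Ico (r + 2) (k + 2),
            ((t.choose r * q * h ^ (t - r) : ℕ) : ℝ) * ((Y : ℝ) ^ b / (D : ℝ) ^ t) ≤
          (Y : ℝ) ^ k * ((Y : ℝ) ^ (k + 1 + a + b) / (D : ℝ) ^ r) := by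
        refine (sum_le_card_nsmul _ _ _ h4).trans ?_
        rw [nsmul_eq_mul, Nat.card_Ico]
        gcongr
        have := succ_le_pow hY k
        have h7 : ((k + 2 - (r + 2) : ℕ) : ℝ) ≤ k := by exact_mod_cast (by omega)
        linarith
      have h8 : (Q : ℝ) * ((Y : ℝ) ^ a / (D : ℝ) ^ r) ≤ (Y : ℝ) ^ (2 * k + 2 + a + b) / (D : ℝ) ^ r := by
        rw [← mul_div_assoc]
        gcongr
        calc (Q : ℝ) * (Y : ℝ) ^ a ≤ (Y : ℝ) ^ b * (Y : ℝ) ^ a := by gcongr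
          _ = (Y : ℝ) ^ (a + b) := by rw [← pow_add, add_comm]
          _ ≤ _ := pow_le_pow_right₀ hYr (by omega)
      have h9 : (Y : ℝ) ^ k * ((Y : ℝ) ^ (k + 1 + a + b) / (D : ℝ) ^ r) ≤
          (Y : ℝ) ^ (2 * k + 2 + a + b) / (D : ℝ) ^ r := by
        rw [← mul_div_assoc, ← pow_add]
        exact div_le_div_of_nonneg_right (pow_le_pow_right₀ hYr (by omega)) (by positivity)
      have h10 : (Y : ℝ) ^ (2 * k + 2 + a + b) / (D : ℝ) ^ r +
          (Y : ℝ) ^ (2 * k + 2 + a + b) / (D : ℝ) ^ r ≤ τ := by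
        rw [hτ, ← add_div]
        gcongr
        have : E = (2 * k + 2 + a + b) + 1 := by omega
        rw [this, pow_succ]
        have h2Y : (2 : ℝ) ≤ Y := by exact_mod_cast hY
        have : 0 < (Y : ℝ) ^ (2 * k + 2 + a + b) := by positivity
        nlinarith
      linarith
    have hcard' : D ≤ (Y ^ a) * #H := hcard
    have hDR : 2 * Y ^ a < D := by
      calc 2 * Y ^ a ≤ Y * Y ^ a := Nat.mul_le_mul_right _ hY
        _ = Y ^ (a + 1) := by ring
        _ < Y ^ (4 * a + b + 2 * k + 10) := Nat.pow_lt_pow_right (by omega) (by omega)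
        _ ≤ D := hYD
    have hDr1 : (1 : ℝ) ≤ D := by exact_mod_cast hDpos
    have hτR : 64 * ((Y ^ a : ℕ) : ℝ) * τ ≤ 1 := by
      rw [hτ, ← mul_div_assoc, div_le_one (by positivity)]
      push_cast
      calc 64 * (Y : ℝ) ^ a * (Y : ℝ) ^ E ≤ (Y : ℝ) ^ 6 * (Y : ℝ) ^ a * (Y : ℝ) ^ E := by
            gcongr
            have := two_pow_le_pow hY 6
            norm_num at this
            exact this
        _ = (Y : ℝ) ^ (6 + a + E) := by rw [← pow_add, ← pow_add]
        _ ≤ (Y : ℝ) ^ (4 * a + b + 2 * k + 10) := pow_le_pow_right₀ hYr (by omega)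
        _ ≤ (D : ℝ) ^ 1 := by simpa using hYDr
        _ ≤ (D : ℝ) ^ r := pow_le_pow_right₀ hDr1 hr1
    obtain ⟨q', hq'1, hq'2, hq'⟩ :=
      exists_nearInt_mul_of_many H hHD hcard' hDR hτR hαnear
    have hq'r : (q' : ℝ) ≤ (Y : ℝ) ^ (a + 1) := by
      have : q' ≤ Y ^ (a + 1) := by
        calc q' ≤ 2 * Y ^ a := hq'2
          _ ≤ Y * Y ^ a := Nat.mul_le_mul_right _ hY
          _ = Y ^ (a + 1) := by ring
      exact_mod_cast this
    have hrr : ((r + 1 : ℕ) : ℝ) ≤ (Y : ℝ) ^ k := by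
      have := succ_le_pow hY k
      have h1 : ((r + 1 : ℕ) : ℝ) ≤ (k : ℝ) + 1 := by exact_mod_cast (by omega)
      linarith
    have hmul : (q' : ℝ) * q * (r + 1 : ℕ) ≤ (Y : ℝ) ^ (2 * a + 1 + k) := by
      calc (q' : ℝ) * q * (r + 1 : ℕ) ≤ (Y : ℝ) ^ (a + 1) * (Y : ℝ) ^ a * (Y : ℝ) ^ k := by gcongr
        _ = (Y : ℝ) ^ (2 * a + 1 + k) := by rw [← pow_add, ← pow_add]; congr 1; omega
    refine ⟨q' * q * (r + 1) * Q, ?_, ?_, ?_⟩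
    · exact Nat.mul_pos (Nat.mul_pos (Nat.mul_pos hq'1 hq1) (by omega)) hQ1
    · have : ((q' * q * (r + 1) * Q : ℕ) : ℝ) ≤ (Y : ℝ) ^ (4 * a + b + 2 * k + 10) := by
        calc ((q' * q * (r + 1) * Q : ℕ) : ℝ) = ((q' : ℝ) * q * (r + 1 : ℕ)) * Q := by push_cast; ring
          _ ≤ (Y : ℝ) ^ (2 * a + 1 + k) * (Y : ℝ) ^ b := by gcongr
          _ = (Y : ℝ) ^ (2 * a + 1 + k + b) := by rw [← pow_add]
          _ ≤ _ := pow_le_pow_right₀ hYr (by omega)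
      exact_mod_cast this
    · intro t ht1 ht2
      rcases Nat.lt_or_ge (k + 1 - j) t with h | h
      · have h1 := (hQ t h ht2).nat_mul (q' * q * (r + 1))
        have e : ((q' * q * (r + 1) * Q : ℕ) : ℝ) * c t =
            ((q' * q * (r + 1) : ℕ) : ℝ) * (Q * c t) := by push_cast; ring
        rw [e]
        refine h1.mono ?_
        rw [← mul_div_assoc]
        gcongr
        calc ((q' * q * (r + 1) : ℕ) : ℝ) * (Y : ℝ) ^ b = ((q' : ℝ) * q * (r + 1 : ℕ)) * (Y : ℝ) ^ b := by
              push_cast; ring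
          _ ≤ (Y : ℝ) ^ (2 * a + 1 + k) * (Y : ℝ) ^ b := by gcongr
          _ = (Y : ℝ) ^ (2 * a + 1 + k + b) := by rw [← pow_add]
          _ ≤ _ := pow_le_pow_right₀ hYr (by omega)
      · have ht : t = r + 1 := by omega
        have e : ((q' * q * (r + 1) * Q : ℕ) : ℝ) * c t = q' * α := by
          rw [ht, hα]; push_cast; ring
        rw [e]
        refine hq'.mono ?_
        rw [hτ, ht, pow_succ (D : ℝ) r, ← mul_div_assoc, div_div]
        gcongr
        push_cast
        calc 16 * ((Y : ℝ) ^ a) ^ 2 * (Y : ℝ) ^ E ≤ (Y : ℝ) ^ 4 * ((Y : ℝ) ^ a) ^ 2 * (Y : ℝ) ^ E := by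
              gcongr
              have := two_pow_le_pow hY 4
              norm_num at this
              exact this
          _ = (Y : ℝ) ^ (4 + a * 2 + E) := by rw [← pow_mul, ← pow_add, ← pow_add]
          _ ≤ _ := pow_le_pow_right₀ hYr (by omega)

lemma norm_sum_range_sub_sum_shift_le (F : ℕ → ℂ) (hF : ∀ x, ‖F x‖ = 1) (D h : ℕ) :
    ‖∑ x ∈ range D, F x - ∑ x ∈ range D, F (x + h)‖ ≤ 2 * h := by
  have h1 := sum_range_add F h D
  have h2 := sum_range_add F D h
  rw [add_comm h D, h2] at h1
  have h3 : ∑ x ∈ range D, F x - ∑ x ∈ range D, F (x + h) =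
      ∑ x ∈ range h, F x - ∑ x ∈ range h, F (D + x) := by
    have : ∑ x ∈ range D, F (x + h) = ∑ x ∈ range D, F (h + x) :=
      sum_congr rfl fun x _ => by rw [add_comm]
    rw [this]
    linear_combination h1
  rw [h3]
  have h4 : ∀ G : ℕ → ℂ, (∀ x, ‖G x‖ = 1) → ‖∑ x ∈ range h, G x‖ ≤ h := by
    intro G hG
    refine (norm_sum_le _ _).trans ?_
    simp [hG]
  refine (norm_sub_le _ _).trans ?_
  linarith [h4 F hF, h4 (fun x => F (D + x)) fun x => hF _]

/-- Two consecutive-progression averages of a bounded function: a large sum over an interval forces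
a large sum over some short progression of step `Q`. -/
lemma exists_large_progression_sum (F : ℕ → ℂ) (hF : ∀ x, ‖F x‖ = 1) {D Y Q J : ℕ} (hY : 0 < Y)
    (hD : 0 < D) (hQJ : 4 * Y * (Q * J) ≤ D) (hS : (D : ℝ) ≤ Y * ‖∑ x ∈ range D, F x‖) :
    ∃ x < D, (J : ℝ) ≤ 2 * Y * ‖∑ j ∈ range J, F (x + Q * j)‖ := by
  by_contra hcon
  push Not at hcon
  have hYr : (0 : ℝ) < Y := by exact_mod_cast hY
  have hDr : (0 : ℝ) < D := by exact_mod_cast hD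
  have hQJr : 4 * (Y : ℝ) * (Q * J) ≤ D := by exact_mod_cast hQJ
  rcases Nat.eq_zero_or_pos J with rfl | hJ
  · have := hcon 0 hD
    simp at this
  have hJr : (0 : ℝ) < J := by exact_mod_cast hJ
  have h1 : 2 * Y * ‖∑ x ∈ range D, ∑ j ∈ range J, F (x + Q * j)‖ < D * J := by
    calc 2 * Y * ‖∑ x ∈ range D, ∑ j ∈ range J, F (x + Q * j)‖
        ≤ 2 * Y * ∑ x ∈ range D, ‖∑ j ∈ range J, F (x + Q * j)‖ := by
          gcongr
          exact norm_sum_le _ _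
      _ = ∑ x ∈ range D, 2 * Y * ‖∑ j ∈ range J, F (x + Q * j)‖ := by rw [mul_sum]
      _ < ∑ x ∈ range D, (J : ℝ) :=
          sum_lt_sum_of_nonempty ⟨0, mem_range.2 hD⟩ fun x hx => hcon x (mem_range.1 hx)
      _ = D * J := by simp
  rw [sum_comm] at h1
  have h2 : ‖∑ j ∈ range J, (∑ x ∈ range D, F x - ∑ x ∈ range D, F (x + Q * j))‖ ≤
      J * (2 * (Q * J)) := by
    refine (norm_sum_le _ _).trans ?_
    refine (sum_le_card_nsmul (range J) _ (2 * (Q * J : ℝ)) ?_).trans (by simp)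
    intro j hj
    refine (norm_sum_range_sub_sum_shift_le F hF D (Q * j)).trans ?_
    push_cast
    have : (j : ℝ) ≤ J := by exact_mod_cast (mem_range.1 hj).le
    gcongr
  rw [sum_sub_distrib, sum_const, card_range, nsmul_eq_mul] at h2
  have h3 : (J : ℝ) * ‖∑ x ∈ range D, F x‖ ≤ J * (2 * (Q * J)) +
      ‖∑ j ∈ range J, ∑ x ∈ range D, F (x + Q * j)‖ := by
    have h4 := norm_sub_norm_le ((J : ℂ) * ∑ x ∈ range D, F x)
      (∑ j ∈ range J, ∑ x ∈ range D, F (x + Q * j))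
    rw [norm_mul, Complex.norm_natCast] at h4
    linarith
  have h5 : 2 * (J * D : ℝ) ≤ 2 * Y * (J * ‖∑ x ∈ range D, F x‖) := by nlinarith
  have h6 : 2 * (Y : ℝ) * (J * ‖∑ x ∈ range D, F x‖) ≤ 2 * Y * (J * (2 * (Q * J)) +
      ‖∑ j ∈ range J, ∑ x ∈ range D, F (x + Q * j)‖) := by gcongr
  have h7 : (J : ℝ) * (4 * Y * (Q * J)) ≤ J * D := by gcongr
  linarith

lemma exists_polyPhase_step (k : ℕ) (c : ℕ → ℝ) (x Q j : ℕ) :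
    ∃ G : ℕ → ℕ, (∀ t, G t ≤ t * (x + Q * j) ^ (t - 1)) ∧
      polyPhase (k + 1) c ((x + Q * j : ℕ) : ℝ) = polyPhase (k + 1) c x + j * (Q * c 1) +
        ∑ t ∈ Ico 2 (k + 2), ((j * G t : ℕ) : ℝ) * (Q * c t) := by
  refine ⟨fun t => ∑ i ∈ range t, (x + Q * j) ^ i * x ^ (t - 1 - i), ?_, ?_⟩
  · intro t
    calc ∑ i ∈ range t, (x + Q * j) ^ i * x ^ (t - 1 - i)
        ≤ ∑ i ∈ range t, (x + Q * j) ^ (t - 1) := by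
          refine sum_le_sum fun i hi => ?_
          rw [mem_range] at hi
          calc (x + Q * j) ^ i * x ^ (t - 1 - i)
              ≤ (x + Q * j) ^ i * (x + Q * j) ^ (t - 1 - i) :=
                Nat.mul_le_mul_left _ (Nat.pow_le_pow_left (by omega) _)
            _ = (x + Q * j) ^ (t - 1) := by
                rw [← pow_add]
                congr 1
                omega
      _ = t * (x + Q * j) ^ (t - 1) := by simp
  · have h : ∀ t, c t * ((x + Q * j : ℕ) : ℝ) ^ t = c t * (x : ℝ) ^ t +
        ((j * ∑ i ∈ range t, (x + Q * j) ^ i * x ^ (t - 1 - i) : ℕ) : ℝ) * (Q * c t) := by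
      intro t
      have := geom_sum₂_mul ((x + Q * j : ℕ) : ℝ) (x : ℝ) t
      push_cast at this ⊢
      linear_combination (-c t) * this
    unfold polyPhase
    rw [sum_congr rfl fun t _ => h t, sum_add_distrib, add_assoc (Finset.sum _ _), add_right_inj]
    have h2 : range (k + 1 + 1) = Ico 0 (k + 2) := range_eq_Ico _
    rw [h2, sum_eq_sum_Ico_succ_bot (by omega), sum_eq_sum_Ico_succ_bot (by omega)]
    simp

/-- If the coefficients of degree at least two are close to rationals with a common small
denominator, a large exponential sum forces the same for the linear coefficient. -/
lemma exists_nearInt_linear_coeff (k b : ℕ) : ∃ b' : ℕ, b ≤ b' ∧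
    ∀ (c : ℕ → ℝ) (D Y Q : ℕ), 2 ≤ Y → Y ^ b' ≤ D →
      (D : ℝ) ≤ Y * ‖∑ x ∈ range D, unitExp (polyPhase (k + 1) c x)‖ → 1 ≤ Q → Q ≤ Y ^ b →
      (∀ t, 2 ≤ t → t ≤ k + 1 → NearInt (Q * c t) ((Y : ℝ) ^ b / (D : ℝ) ^ t)) →
      NearInt (Q * c 1) ((Y : ℝ) ^ b' / D) := by
  refine ⟨3 * k + b + 9 + 3, by omega, ?_⟩
  intro c D Y Q hY hYD hS hQ1 hQb hQ
  set m := 3 * k + b + 9 with hm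
  set J := D / Y ^ m with hJ
  have hY1 : 1 ≤ Y := by omega
  have hYr : (2 : ℝ) ≤ Y := by exact_mod_cast hY
  have hYr1 : (1 : ℝ) ≤ Y := by linarith
  have hYmpos : 0 < Y ^ m := pow_pos hY1 _
  have hDpos : 0 < D := (pow_pos hY1 _).trans_le hYD
  have hDr : (0 : ℝ) < D := by exact_mod_cast hDpos
  have hJle : J * Y ^ m ≤ D := Nat.div_mul_le_self _ _
  have hJlt : D < (J + 1) * Y ^ m := by
    rw [mul_comm]
    exact Nat.lt_mul_div_succ D hYmpos
  have h8 : 8 ≤ Y ^ 3 := by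
    calc 8 = 2 ^ 3 := by norm_num
      _ ≤ Y ^ 3 := Nat.pow_le_pow_left hY 3
  have hJ1 : 1 ≤ J := by
    rw [hJ, Nat.one_le_div_iff hYmpos]
    exact (Nat.pow_le_pow_right hY1 (by omega)).trans hYD
  have hJr : (1 : ℝ) ≤ J := by exact_mod_cast hJ1
  have hQJ : 4 * Y * (Q * J) ≤ D := by
    calc 4 * Y * (Q * J) ≤ Y ^ 2 * Y * (Y ^ b * J) := by
          have : 4 ≤ Y ^ 2 := by nlinarith
          gcongr
      _ = J * Y ^ (b + 3) := by ring
      _ ≤ J * Y ^ m := Nat.mul_le_mul_left _ (Nat.pow_le_pow_right hY1 (by omega))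
      _ ≤ D := hJle
  obtain ⟨x, hxD, hx⟩ := exists_large_progression_sum
    (fun x : ℕ => unitExp (polyPhase (k + 1) c x)) (fun _ => norm_unitExp _) hY1 hDpos hQJ hS
  have herr : ∀ j ∈ range J, ‖unitExp (polyPhase (k + 1) c ((x + Q * j : ℕ) : ℝ)) -
      unitExp (polyPhase (k + 1) c x + j * (Q * c 1))‖ ≤ 1 / (4 * Y) := by
    intro j hj
    rw [mem_range] at hj
    obtain ⟨G, hG, hGeq⟩ := exists_polyPhase_step k c x Q j
    have hxQ : x + Q * j ≤ 2 * D := by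
      have : Q * j ≤ Q * J := Nat.mul_le_mul_left _ hj.le
      nlinarith
    have hnear : NearInt (∑ t ∈ Ico 2 (k + 2), ((j * G t : ℕ) : ℝ) * (Q * c t))
        (∑ t ∈ Ico 2 (k + 2), ((j * G t : ℕ) : ℝ) * ((Y : ℝ) ^ b / (D : ℝ) ^ t)) := by
      apply NearInt.sum
      intro t ht
      rw [mem_Ico] at ht
      exact (hQ t (by omega) (by omega)).nat_mul _
    have hterm : ∀ t ∈ Ico 2 (k + 2), ((j * G t : ℕ) : ℝ) * ((Y : ℝ) ^ b / (D : ℝ) ^ t) ≤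
        (Y : ℝ) ^ (2 * k + 1 + b) / (Y : ℝ) ^ m := by
      intro t ht
      rw [mem_Ico] at ht
      have h1 : (J : ℝ) / D ≤ 1 / (Y : ℝ) ^ m := by
        rw [div_le_div_iff₀ hDr (by positivity), one_mul]
        exact_mod_cast hJle
      have h2 : (G t : ℝ) ≤ (Y : ℝ) ^ (k + 1) * ((Y : ℝ) ^ k * (D : ℝ) ^ (t - 1)) := by
        have h3 : G t ≤ t * (2 * D) ^ (t - 1) :=
          (hG t).trans (Nat.mul_le_mul_left _ (Nat.pow_le_pow_left hxQ _))
        have h4 : (G t : ℝ) ≤ t * (2 * D) ^ (t - 1) := by exact_mod_cast h3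
        refine h4.trans ?_
        rw [mul_pow]
        gcongr
        · have h5 := succ_le_pow hY (k + 1)
          have h6 : (t : ℝ) ≤ ((k + 1 : ℕ) : ℝ) := by exact_mod_cast (by omega)
          linarith
        · exact (two_pow_le_pow hY _).trans (pow_le_pow_right₀ hYr1 (by omega))
      have hDt : (D : ℝ) ^ t = (D : ℝ) ^ (t - 1) * D := by
        rw [← pow_succ]
        congr 1
        omega
      push_cast
      calc (j : ℝ) * G t * ((Y : ℝ) ^ b / (D : ℝ) ^ t)
          ≤ J * ((Y : ℝ) ^ (k + 1) * ((Y : ℝ) ^ k * (D : ℝ) ^ (t - 1))) *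
            ((Y : ℝ) ^ b / (D : ℝ) ^ t) := by
            have : (j : ℝ) ≤ J := by exact_mod_cast hj.le
            gcongr
        _ = (Y : ℝ) ^ (2 * k + 1 + b) * (J / D) := by
            rw [hDt]
            field_simp
            ring
        _ ≤ (Y : ℝ) ^ (2 * k + 1 + b) * (1 / (Y : ℝ) ^ m) := by gcongr
        _ = _ := by ring
    have hsum : ∑ t ∈ Ico 2 (k + 2), ((j * G t : ℕ) : ℝ) * ((Y : ℝ) ^ b / (D : ℝ) ^ t) ≤
        1 / (28 * Y) := by
      refine (sum_le_card_nsmul _ _ _ hterm).trans ?_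
      rw [nsmul_eq_mul, Nat.card_Ico, add_tsub_cancel_right, ← mul_div_assoc,
        div_le_div_iff₀ (by positivity) (by positivity), one_mul]
      have h1 := succ_le_pow hY k
      have h2 : (28 : ℝ) ≤ (Y : ℝ) ^ 5 := by
        have := two_pow_le_pow hY 5
        linarith
      calc (k : ℝ) * (Y : ℝ) ^ (2 * k + 1 + b) * (28 * Y)
          ≤ (Y : ℝ) ^ k * (Y : ℝ) ^ (2 * k + 1 + b) * ((Y : ℝ) ^ 5 * Y) := by
            gcongr
            linarith
        _ = (Y : ℝ) ^ (3 * k + b + 7) := by ring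
        _ ≤ (Y : ℝ) ^ m := pow_le_pow_right₀ hYr1 (by omega)
    rw [hGeq, unitExp_add, ← mul_sub_one, norm_mul, norm_unitExp, one_mul]
    refine ((hnear.mono hsum).norm_unitExp_sub_one_le).trans (le_of_eq ?_)
    field_simp
    norm_num
  have hlin : (J : ℝ) ≤ 4 * Y *
      ‖∑ j ∈ range J, unitExp (polyPhase (k + 1) c x + j * (Q * c 1))‖ := by
    have h1 : ‖∑ j ∈ range J, unitExp (polyPhase (k + 1) c ((x + Q * j : ℕ) : ℝ)) -
        ∑ j ∈ range J, unitExp (polyPhase (k + 1) c x + j * (Q * c 1))‖ ≤ J * (1 / (4 * Y)) := by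
      rw [← sum_sub_distrib]
      refine (norm_sum_le _ _).trans ((sum_le_card_nsmul _ _ _ herr).trans ?_)
      simp
    have h2 := norm_sub_norm_le
      (∑ j ∈ range J, unitExp (polyPhase (k + 1) c ((x + Q * j : ℕ) : ℝ)))
      (∑ j ∈ range J, unitExp (polyPhase (k + 1) c x + j * (Q * c 1)))
    have h3 : (4 : ℝ) * Y * (J * (1 / (4 * Y))) = J := by field_simp
    have h4 := h2.trans h1
    have h5 : (0 : ℝ) < 4 * Y := by linarith
    have h6 := mul_le_mul_of_nonneg_left h4 h5.le
    rw [h3] at h6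
    linarith
  have h1 := norm_sum_unitExp_linear_mul_le (Q * c 1) (polyPhase (k + 1) c x) J
  have h2 : ‖unitExp (Q * c 1) - 1‖ * J ≤ 8 * Y := by
    calc ‖unitExp (Q * c 1) - 1‖ * J ≤ ‖unitExp (Q * c 1) - 1‖ * (4 * Y *
      ‖∑ j ∈ range J, unitExp (polyPhase (k + 1) c x + j * (Q * c 1))‖) := by gcongr
      _ = 4 * Y * (‖∑ j ∈ range J, unitExp (polyPhase (k + 1) c x + j * (Q * c 1))‖ *
        ‖unitExp (Q * c 1) - 1‖) := by ring
      _ ≤ 4 * Y * 2 := by gcongr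
      _ = 8 * Y := by ring
  refine (nearInt_norm_unitExp_sub_one (Q * c 1)).mono ?_
  have h3 : (D : ℝ) ≤ 2 * J * (Y : ℝ) ^ m := by
    have h4 : (D : ℝ) < (J + 1) * (Y : ℝ) ^ m := by exact_mod_cast hJlt
    refine h4.le.trans ?_
    gcongr
    linarith
  rw [div_le_div_iff₀ (by norm_num) hDr]
  have h4 : (4 : ℝ) ≤ (Y : ℝ) ^ 2 := by nlinarith
  calc ‖unitExp (Q * c 1) - 1‖ * D ≤ ‖unitExp (Q * c 1) - 1‖ * (2 * J * (Y : ℝ) ^ m) := by gcongr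
    _ = ‖unitExp (Q * c 1) - 1‖ * J * (2 * (Y : ℝ) ^ m) := by ring
    _ ≤ 8 * Y * (2 * (Y : ℝ) ^ m) := by gcongr
    _ = 4 * Y * (Y : ℝ) ^ m * 4 := by ring
    _ ≤ (Y : ℝ) ^ 2 * Y * (Y : ℝ) ^ m * 4 := by gcongr
    _ = (Y : ℝ) ^ (m + 3) * 4 := by ring

/-- **Weyl's inequality**, inverse form: a large exponential sum forces the nonconstant
coefficients of the phase to be close to rationals with a common small denominator. -/
theorem exists_denominator_of_large_sum (k : ℕ) : ∃ C : ℕ, ∀ (c : ℕ → ℝ) (D Y : ℕ), 2 ≤ Y → 0 < D →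
    (D : ℝ) ≤ Y * ‖∑ x ∈ range D, unitExp (polyPhase k c x)‖ →
    ∃ q : ℕ, 1 ≤ q ∧ q ≤ Y ^ C ∧
      ∀ r, 1 ≤ r → r ≤ k → NearInt (q * c r) ((Y : ℝ) ^ C / (D : ℝ) ^ r) := by
  induction k with
  | zero =>
    refine ⟨0, fun c D Y _ _ _ => ⟨1, le_rfl, by simp, ?_⟩⟩
    intro r h1 h2
    omega
  | succ k ih =>
    obtain ⟨C, hC⟩ := ih
    obtain ⟨b, hb⟩ := exists_denominator_of_diffCoeff k (5 * C + 5 * k + 5) k le_rfl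
    obtain ⟨b', hbb', hb'⟩ := exists_nearInt_linear_coeff k b
    set a := 5 * C + 5 * k + 5 with ha
    refine ⟨(b' + 6) * (k + 1), ?_⟩
    intro c D Y hY hD hS
    have hY1 : 1 ≤ Y := by omega
    have hYr : (2 : ℝ) ≤ Y := by exact_mod_cast hY
    have hYr1 : (1 : ℝ) ≤ Y := by linarith
    have hDr : (0 : ℝ) < D := by exact_mod_cast hD
    have hbC : b' ≤ (b' + 6) * (k + 1) := by nlinarith
    rcases lt_or_ge D (Y ^ (b' + 6)) with hDY | hDY
    · refine ⟨1, le_rfl, Nat.one_le_pow _ _ hY1, fun r hr1 hrk => nearInt_of_pow_le hD ?_⟩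
      rcases Nat.eq_zero_or_pos D with h | h
      · omega
      · calc D ^ r ≤ D ^ (k + 1) := Nat.pow_le_pow_right hD hrk
          _ ≤ (Y ^ (b' + 6)) ^ (k + 1) := Nat.pow_le_pow_left hDY.le _
          _ = _ := by rw [← pow_mul]
    · have h4 : 4 * Y ^ 2 ≤ Y ^ 4 := by nlinarith [Nat.pow_le_pow_left hY 2]
      have h8 : 8 * (Y : ℝ) ^ 2 ≤ (Y : ℝ) ^ 5 := by
        have := two_pow_le_pow hY 3
        nlinarith [sq_nonneg (Y : ℝ)]
      have h4D : 4 * Y ^ 2 ≤ D :=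
        h4.trans ((Nat.pow_le_pow_right hY1 (by omega)).trans hDY)
      obtain ⟨H, hHD, hHcard, hH⟩ := exists_many_large_correlations
        (fun x : ℕ => unitExp (polyPhase (k + 1) c x)) (fun _ => norm_unitExp _) h4D hY1 hS
      have key : ∀ h, ∃ q : ℕ, h ∈ H → (1 ≤ q ∧ q ≤ Y ^ (5 * C) ∧ ∀ r, 1 ≤ r → r ≤ k →
          NearInt (q * diffCoeff k c h r) ((Y : ℝ) ^ a / (D : ℝ) ^ r)) := by
        intro h
        by_cases hh : h ∈ H
        swap
        · exact ⟨0, fun h' => absurd h' hh⟩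
        obtain ⟨h1, h2⟩ := hH h hh
        have hhD := mem_range.1 (hHD hh)
        have h3 : ∑ x ∈ range (D - h), unitExp (polyPhase (k + 1) c ((x + h : ℕ) : ℝ)) *
            starRingEnd ℂ (unitExp (polyPhase (k + 1) c x)) =
            ∑ x ∈ range (D - h), unitExp (polyPhase k (diffCoeff k c h) x) := by
          refine sum_congr rfl fun x _ => ?_
          rw [← unitExp_sub, ← polyPhase_add_sub]
          push_cast
          rfl
        rw [h3] at h2
        have h5 : (D : ℝ) ≤ 8 * (Y : ℝ) ^ 2 * ((D - h : ℕ) : ℝ) := by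
          refine h2.trans ?_
          gcongr
          refine (norm_sum_le _ _).trans ?_
          simp [norm_unitExp]
        have hDhr : (0 : ℝ) < ((D - h : ℕ) : ℝ) := by exact_mod_cast (by omega)
        obtain ⟨q, hq1, hqC, hq⟩ := hC (diffCoeff k c h) (D - h) (Y ^ 5)
          (hY.trans (Nat.le_self_pow (by norm_num) Y)) (by omega) (by
            have h6 : ((D - h : ℕ) : ℝ) ≤ D := by exact_mod_cast Nat.sub_le _ _
            refine h6.trans (h2.trans ?_)
            push_cast
            gcongr)
        refine ⟨q, fun _ => ⟨hq1, by rwa [pow_mul], fun r hr1 hrk => (hq r hr1 hrk).mono ?_⟩⟩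
        rw [div_le_div_iff₀ (by positivity) (by positivity)]
        push_cast
        calc ((Y : ℝ) ^ 5) ^ C * (D : ℝ) ^ r
            ≤ ((Y : ℝ) ^ 5) ^ C * ((Y : ℝ) ^ 5 * ((D - h : ℕ) : ℝ)) ^ r := by
              gcongr
              exact h5.trans (by gcongr)
          _ = (Y : ℝ) ^ (5 * C + 5 * r) * ((D - h : ℕ) : ℝ) ^ r := by
              rw [mul_pow, pow_add, pow_mul, pow_mul]
              ring
          _ ≤ (Y : ℝ) ^ a * ((D - h : ℕ) : ℝ) ^ r := by
              gcongr
              omega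
      choose f hf using key
      have hne : (Icc 1 (Y ^ (5 * C))).Nonempty := ⟨1, by simp [Nat.one_le_pow _ _ hY1]⟩
      have hcardpos : (0 : ℝ) < #(Icc 1 (Y ^ (5 * C))) := by exact_mod_cast hne.card_pos
      obtain ⟨q, hqmem, hq⟩ := exists_le_card_fiber_of_nsmul_le_card_of_maps_to (s := H) (f := f)
        (t := Icc 1 (Y ^ (5 * C))) (b := (#H : ℝ) / #(Icc 1 (Y ^ (5 * C))))
        (fun h hh => mem_Icc.2 ⟨(hf h hh).1, (hf h hh).2.1⟩) hne (by
          rw [nsmul_eq_mul]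
          exact (mul_div_cancel₀ _ hcardpos.ne').le)
      set H' := {h ∈ H | f h = q} with hH'
      have hfib : #H ≤ Y ^ (5 * C) * #H' := by
        rw [div_le_iff₀ hcardpos, Nat.card_Icc, add_tsub_cancel_right] at hq
        rw [mul_comm]
        exact_mod_cast hq
      rw [mem_Icc] at hqmem
      have hcard' : D ≤ Y ^ a * #H' := by
        calc D ≤ 4 * Y ^ 2 * #H := hHcard
          _ ≤ Y ^ 4 * (Y ^ (5 * C) * #H') := Nat.mul_le_mul h4 hfib
          _ = Y ^ (4 + 5 * C) * #H' := by ring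
          _ ≤ Y ^ a * #H' := Nat.mul_le_mul_right _ (Nat.pow_le_pow_right hY1 (by omega))
      obtain ⟨Q, hQ1, hQb, hQ⟩ := hb c D Y H' q hY
        ((Nat.pow_le_pow_right hY1 (by omega)).trans hDY) ((filter_subset _ _).trans hHD) hcard'
        hqmem.1 (hqmem.2.trans (Nat.pow_le_pow_right hY1 (by omega))) (by
          intro h hh r hr1 hrk
          rw [hH', mem_filter] at hh
          have := (hf h hh.1).2.2 r hr1 hrk
          rwa [hh.2] at this)
      have hlin := hb' c D Y Q hY ((Nat.pow_le_pow_right hY1 (by omega)).trans hDY) hS hQ1 hQb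
        (fun t ht1 ht2 => hQ t (by omega) ht2)
      refine ⟨Q, hQ1, hQb.trans (Nat.pow_le_pow_right hY1 (by omega)), fun r hr1 hrk => ?_⟩
      rcases eq_or_lt_of_le hr1 with rfl | hr
      · refine hlin.mono ?_
        rw [pow_one]
        gcongr
      · refine (hQ r (by omega) hrk).mono ?_
        have : (Y : ℝ) ^ b ≤ (Y : ℝ) ^ ((b' + 6) * (k + 1)) :=
          pow_le_pow_right₀ hYr1 (by omega)
        gcongr

lemma abs_updateCol_le {ι : Type*} [DecidableEq ι] {B : Matrix ι ι ℤ} {M : ℕ} (hB : ∀ i j, |B i j| ≤ M) {v : ι → ℤ}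
    (hv : ∀ j, |v j| ≤ M) (i : ι) : ∀ j l, |B.updateCol i v j l| ≤ M := by
  intro j l
  rw [Matrix.updateCol_apply]
  split_ifs
  · exact hv j
  · exact hB j l

section Recurrence

variable {ι : Type*} [Fintype ι] [DecidableEq ι]

/-- The coefficient of degree `r` of the integer combination, with coefficients `v`, of the
polynomials with coefficients `a j`. -/
def combCoeff (a : ι → ℕ → ℝ) (v : ι → ℤ) (r : ℕ) : ℝ := ∑ j, v j * a j r

lemma det_mul_combCoeff (a : ι → ℕ → ℝ) (B : Matrix ι ι ℤ) (v : ι → ℤ) (r : ℕ) :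
    (B.det : ℝ) * combCoeff a v r = ∑ i, (B.cramer v i : ℝ) * combCoeff a (fun j => B j i) r := by
  have h : ∀ j, (B.det : ℝ) * v j = ∑ i, (B j i : ℝ) * B.cramer v i := by
    intro j
    have := congrFun (Matrix.mulVec_cramer B v) j
    simp only [Matrix.mulVec, dotProduct, Pi.smul_apply, smul_eq_mul] at this
    exact_mod_cast this.symm
  simp only [combCoeff, mul_sum]
  rw [sum_comm]
  refine sum_congr rfl fun j _ => ?_
  rw [← mul_assoc, h, sum_mul]
  exact sum_congr rfl fun i _ => by ring

lemma natAbs_det_le {B : Matrix ι ι ℤ} {M : ℕ} (hB : ∀ i j, |B i j| ≤ M) :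
    B.det.natAbs ≤ (Fintype.card ι).factorial * M ^ Fintype.card ι := by
  have h := Matrix.det_le (abv := AbsoluteValue.abs) (x := (M : ℤ)) hB
  simp only [AbsoluteValue.abs_apply, nsmul_eq_mul] at h
  zify
  exact h

/-- If `v` is a rational combination of the columns of `B` indexed by `I`, and the corresponding
phases are close to integers, then the phase of `v` has an exponential sum with nonnegative
real part. -/
lemma re_sum_nonneg_of_cramer_eq_zero {k : ℕ} {a : ι → ℕ → ℝ} (ha : ∀ j, a j 0 = 0)
    {B : Matrix ι ι ℤ} {M X D q₀ : ℕ} {I : Finset ι} {v : ι → ℤ}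
    (hX : 2 ≤ X) (hXL : Fintype.card ι * ((Fintype.card ι).factorial * M ^ Fintype.card ι) ≤ X)
    (hX' : (Fintype.card ι).factorial * M ^ Fintype.card ι ≤ X)
    (hB : ∀ i j, |B i j| ≤ M) (hD : 0 < D)
    (hI : ∀ i ∈ I, ∀ r, 1 ≤ r → r ≤ k →
      NearInt ((q₀ : ℝ) ^ r * combCoeff a (fun j => B j i) r) ((1 / (D : ℝ)) ^ r))
    (hv : ∀ j, |v j| ≤ M) (hcr : ∀ j ∉ I, B.cramer v j = 0) :
    0 ≤ (∑ d ∈ range (D / X ^ (k + 4)), unitExp (polyPhase k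
      (fun r => ((B.det.natAbs * q₀ : ℕ) : ℝ) ^ r * combCoeff a v r) d)).re := by
  have hX1 : 1 ≤ X := by omega
  have hXr : (2 : ℝ) ≤ X := by exact_mod_cast hX
  have hXr1 : (1 : ℝ) ≤ X := by linarith
  have hDr : (0 : ℝ) < D := by exact_mod_cast hD
  rw [Complex.re_sum]
  refine sum_nonneg fun d hd => ?_
  rw [mem_range] at hd
  have hdX : (d : ℝ) * (X : ℝ) ^ (k + 4) ≤ D := by
    have : d * X ^ (k + 4) ≤ D := (Nat.mul_le_mul_right _ hd.le).trans (Nat.div_mul_le_self _ _)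
    exact_mod_cast this
  have hdet : (B.det.natAbs : ℝ) ≤ X := by exact_mod_cast (natAbs_det_le hB).trans hX'
  have hcoef : ∀ r, 1 ≤ r → r ≤ k → NearInt (((B.det.natAbs * q₀ : ℕ) : ℝ) ^ r * combCoeff a v r)
      ((X / D : ℝ) ^ r) := by
    intro r hr1 hrk
    obtain ⟨s, rfl⟩ : ∃ s, r = s + 1 := ⟨r - 1, by omega⟩
    obtain ⟨ε, hε, hεd⟩ : ∃ ε : ℤ, |ε| = 1 ∧ (B.det.natAbs : ℤ) = ε * B.det := by
      rcases Int.natAbs_eq B.det with h | h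
      · exact ⟨1, by simp, by omega⟩
      · exact ⟨-1, by simp, by omega⟩
    have hεr : (B.det.natAbs : ℝ) = ε * B.det := by
      rw [← Int.cast_mul, ← hεd, Int.cast_natCast]
    have h1 : ((B.det.natAbs * q₀ : ℕ) : ℝ) ^ (s + 1) * combCoeff a v (s + 1) =
        ∑ i ∈ I, (((B.det.natAbs : ℤ) ^ s * (ε * B.cramer v i) : ℤ) : ℝ) *
          ((q₀ : ℝ) ^ (s + 1) * combCoeff a (fun j => B j i) (s + 1)) := by
      have h2 := det_mul_combCoeff a B v (s + 1)
      rw [← sum_subset (subset_univ I) (fun i _ hi => by rw [hcr i hi]; simp)] at h2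
      simp only [Nat.cast_mul, Int.cast_mul, Int.cast_pow, Int.cast_natCast]
      calc ((B.det.natAbs : ℝ) * q₀) ^ (s + 1) * combCoeff a v (s + 1)
          = (B.det.natAbs : ℝ) ^ s * (q₀ : ℝ) ^ (s + 1) *
            ((B.det.natAbs : ℝ) * combCoeff a v (s + 1)) := by ring
        _ = (B.det.natAbs : ℝ) ^ s * (q₀ : ℝ) ^ (s + 1) *
            (ε * ((B.det : ℝ) * combCoeff a v (s + 1))) := by rw [hεr]; ring
        _ = _ := by
            rw [h2, mul_sum, mul_sum]
            refine sum_congr rfl fun i _ => ?_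
            ring
    rw [h1]
    refine (NearInt.sum I fun i hi => (hI i hi (s + 1) hr1 hrk).int_mul _).mono ?_
    have h3 : ∀ i ∈ I, |((((B.det.natAbs : ℤ) ^ s * (ε * B.cramer v i) : ℤ)) : ℝ)| *
        (1 / (D : ℝ)) ^ (s + 1) ≤ (X : ℝ) ^ s *
          (((Fintype.card ι).factorial * M ^ Fintype.card ι : ℕ) : ℝ) * (1 / (D : ℝ)) ^ (s + 1) := by
      intro i _
      have h4 : |(B.cramer v i : ℝ)| ≤
          (((Fintype.card ι).factorial * M ^ Fintype.card ι : ℕ) : ℝ) := by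
        have h5 := natAbs_det_le (abs_updateCol_le hB hv i)
        rw [← Matrix.cramer_apply] at h5
        zify at h5
        exact_mod_cast h5
      have h6 : |(ε : ℝ)| = 1 := by exact_mod_cast hε
      have h7 : (((B.det.natAbs : ℤ) : ℝ)) ≤ X := by exact_mod_cast hdet
      rw [Int.cast_mul, Int.cast_mul, Int.cast_pow, abs_mul, abs_mul, h6, one_mul, abs_pow,
        abs_of_nonneg (by positivity : (0 : ℝ) ≤ ((B.det.natAbs : ℤ) : ℝ))]
      gcongr
    refine (sum_le_card_nsmul _ _ _ h3).trans ?_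
    rw [nsmul_eq_mul, ← mul_assoc, one_div, inv_pow, ← div_eq_mul_inv, div_pow]
    apply div_le_div_of_nonneg_right _ (by positivity)
    have hIc : (#I : ℝ) ≤ (Fintype.card ι : ℝ) := by exact_mod_cast card_le_univ I
    have hXLr : (Fintype.card ι : ℝ) *
        (((Fintype.card ι).factorial * M ^ Fintype.card ι : ℕ) : ℝ) ≤ X := by exact_mod_cast hXL
    calc (#I : ℝ) * ((X : ℝ) ^ s * (((Fintype.card ι).factorial * M ^ Fintype.card ι : ℕ) : ℝ))
        ≤ (Fintype.card ι : ℝ) *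
          ((X : ℝ) ^ s * (((Fintype.card ι).factorial * M ^ Fintype.card ι : ℕ) : ℝ)) := by gcongr
      _ = (X : ℝ) ^ s * ((Fintype.card ι : ℝ) *
          (((Fintype.card ι).factorial * M ^ Fintype.card ι : ℕ) : ℝ)) := by ring
      _ ≤ (X : ℝ) ^ s * X := by gcongr
      _ = _ := by ring
  have hphase : NearInt (polyPhase k
      (fun r => ((B.det.natAbs * q₀ : ℕ) : ℝ) ^ r * combCoeff a v r) d)
      (∑ r ∈ range (k + 1), if r = 0 then 0 else 1 / (X : ℝ) ^ (k + 3)) := by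
    unfold polyPhase
    apply NearInt.sum
    intro r hr
    rw [mem_range] at hr
    split_ifs with h0
    · subst h0
      refine ⟨0, ?_⟩
      simp [combCoeff, ha]
    · rw [mul_comm]
      have h1 := (hcoef r (by omega) (by omega)).nat_mul (d ^ r)
      push_cast at h1 ⊢
      refine h1.mono ?_
      rw [← mul_pow]
      have h2 : (d : ℝ) * (X / D) ≤ 1 / (X : ℝ) ^ (k + 3) := by
        rw [← mul_div_assoc, div_le_div_iff₀ hDr (by positivity), one_mul]
        calc (d : ℝ) * X * (X : ℝ) ^ (k + 3) = d * (X : ℝ) ^ (k + 4) := by ring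
          _ ≤ D := hdX
      have h3 : 1 / (X : ℝ) ^ (k + 3) ≤ 1 := by
        rw [div_le_one (by positivity)]
        exact one_le_pow₀ hXr1
      calc ((d : ℝ) * (X / D)) ^ r ≤ ((d : ℝ) * (X / D)) ^ 1 :=
            pow_le_pow_of_le_one (by positivity) (h2.trans h3) (by omega)
        _ ≤ _ := by rwa [pow_one]
  have hle : ∑ r ∈ range (k + 1), (if r = 0 then 0 else 1 / (X : ℝ) ^ (k + 3)) ≤ 1 / 7 := by
    rw [sum_range_succ']
    simp only [Nat.add_eq_zero_iff, one_ne_zero, and_false, if_false, sum_const, card_range,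
      nsmul_eq_mul, if_true, add_zero]
    rw [mul_one_div, div_le_div_iff₀ (by positivity) (by norm_num), one_mul, pow_add]
    have h1 := succ_le_pow hX k
    have h2 : (8 : ℝ) ≤ (X : ℝ) ^ 3 := by
      have := two_pow_le_pow hX 3
      linarith
    have h3 : (0 : ℝ) ≤ k := Nat.cast_nonneg k
    nlinarith
  have hfin := (hphase.mono hle).norm_unitExp_sub_one_le
  have h9 := (Complex.abs_re_le_norm _).trans hfin
  rw [Complex.sub_re, Complex.one_re, abs_le] at h9
  linarith [h9.1]

/-- One can find a modulus `q` and a scale `D` such that all integer combinations, with bounded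
coefficients, of given polynomials have averages over multiples of `q` up to scale `D` with almost
nonnegative real parts. The number of polynomials is the cardinality of `ι`. -/
lemma exists_modulus_of_basis (k : ℕ) : ∃ E : ℕ, ∀ {ι : Type} [Fintype ι] [DecidableEq ι]
    (a : ι → ℕ → ℝ) (M X : ℕ), (∀ j, a j 0 = 0) → 2 ≤ X →
    Fintype.card ι * ((Fintype.card ι).factorial * M ^ Fintype.card ι) ≤ X →
    (Fintype.card ι).factorial * M ^ Fintype.card ι ≤ X →
    ∀ (n : ℕ) (I : Finset ι) (B : Matrix ι ι ℤ) (q₀ D : ℕ), #Iᶜ = n → B.det ≠ 0 →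
      (∀ i j, |B i j| ≤ M) → 1 ≤ q₀ → X ^ (E * (n + 1)) ≤ D →
      (∀ i ∈ I, ∀ r, 1 ≤ r → r ≤ k →
        NearInt ((q₀ : ℝ) ^ r * combCoeff a (fun j => B j i) r) ((1 / (D : ℝ)) ^ r)) →
      ∃ q D' : ℕ, 1 ≤ q ∧ X ≤ D' ∧ q * D' ≤ q₀ * D ∧ ∀ v : ι → ℤ, (∀ j, |v j| ≤ M) →
        -(D' / X : ℝ) ≤ (∑ d ∈ range D', unitExp (polyPhase k
          (fun r => (q : ℝ) ^ r * combCoeff a v r) d)).re := by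
  obtain ⟨C, hC⟩ := exists_denominator_of_large_sum k
  refine ⟨C + (k + 4) + 1, ?_⟩
  intro ι _ _ a M X ha hX hXL hX' n
  have hX1 : 1 ≤ X := by omega
  have hXr : (2 : ℝ) ≤ X := by exact_mod_cast hX
  have hXr1 : (1 : ℝ) ≤ X := by linarith
  have hX0 : (0 : ℝ) < X := by linarith
  induction n using Nat.strong_induction_on with
  | _ n ih =>
  intro I B q₀ D hn hdet hB hq hXD hI
  set D₁ := D / X ^ (k + 4) with hD₁
  obtain ⟨δ, hδ⟩ : ∃ δ, δ = B.det.natAbs := ⟨_, rfl⟩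
  have hδX : δ ≤ X := hδ ▸ (natAbs_det_le hB).trans hX'
  have hδ1 : 1 ≤ δ := by
    have := Int.natAbs_pos.2 hdet
    omega
  have hDpos : 0 < D := (pow_pos hX1 _).trans_le hXD
  have hD₁X : X ^ ((C + (k + 4) + 1) * n + 1 + C) ≤ D₁ := by
    rw [hD₁, Nat.le_div_iff_mul_le (pow_pos hX1 _), ← pow_add]
    refine (Nat.pow_le_pow_right hX1 ?_).trans hXD
    nlinarith
  have hD₁D : D₁ * X ^ (k + 4) ≤ D := Nat.div_mul_le_self _ _
  have hXD₁ : δ * D₁ ≤ D := by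
    calc δ * D₁ ≤ X ^ (k + 4) * D₁ :=
          Nat.mul_le_mul_right _ (hδX.trans (Nat.le_self_pow (by omega) X))
      _ ≤ D := by rwa [mul_comm]
  have hD₁pos : 0 < D₁ := (pow_pos hX1 _).trans_le hD₁X
  have hD₁r : (0 : ℝ) < D₁ := by exact_mod_cast hD₁pos
  by_cases hgood : ∀ v : ι → ℤ, (∀ j, |v j| ≤ M) →
      -(D₁ / X : ℝ) ≤ (∑ d ∈ range D₁, unitExp (polyPhase k
        (fun r => ((δ * q₀ : ℕ) : ℝ) ^ r * combCoeff a v r) d)).re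
  · refine ⟨δ * q₀, D₁, Nat.mul_pos hδ1 hq, ?_, ?_, hgood⟩
    · exact (Nat.le_self_pow (by omega) X).trans hD₁X
    · calc δ * q₀ * D₁ = q₀ * (δ * D₁) := by ring
        _ ≤ q₀ * D := Nat.mul_le_mul_left _ hXD₁
  push Not at hgood
  obtain ⟨v, hv, hlt⟩ := hgood
  obtain ⟨j, hjI, hj⟩ : ∃ j ∉ I, B.cramer v j ≠ 0 := by
    by_contra hcon
    push Not at hcon
    have h1 := re_sum_nonneg_of_cramer_eq_zero ha hX hXL hX' hB hDpos hI hv hcon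
    rw [← hδ] at h1
    have : (0 : ℝ) ≤ D₁ / X := by positivity
    linarith
  have hlarge : (D₁ : ℝ) ≤ X * ‖∑ d ∈ range D₁, unitExp (polyPhase k
      (fun r => ((δ * q₀ : ℕ) : ℝ) ^ r * combCoeff a v r) d)‖ := by
    rw [mul_comm, ← div_le_iff₀ hX0]
    refine le_trans ?_ (Complex.abs_re_le_norm _)
    refine le_trans ?_ (neg_le_abs _)
    linarith
  obtain ⟨q₂, hq₂, hq₂C, hnear⟩ := hC _ D₁ X hX hD₁pos hlarge
  have hnpos : 1 ≤ n := by
    rw [← hn]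
    exact card_pos.2 ⟨j, by simpa using hjI⟩
  set D₂ := D₁ / X ^ C with hD₂
  have hD₂D₁ : D₂ * X ^ C ≤ D₁ := Nat.div_mul_le_self _ _
  have hD₂X : X ^ ((C + (k + 4) + 1) * n) ≤ D₂ := by
    rw [hD₂, Nat.le_div_iff_mul_le (pow_pos hX1 _), ← pow_add]
    exact (Nat.pow_le_pow_right hX1 (by omega)).trans hD₁X
  have hD₂pos : 0 < D₂ := (pow_pos hX1 _).trans_le hD₂X
  have hD₂r : (0 : ℝ) < D₂ := by exact_mod_cast hD₂pos
  have hDr : (0 : ℝ) < D := by exact_mod_cast hDpos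
  have hq₂r : (q₂ : ℝ) ≤ (X : ℝ) ^ C := by exact_mod_cast hq₂C
  have hX₂ : (X : ℝ) ^ C / D₁ ≤ 1 / D₂ := by
    rw [div_le_div_iff₀ hD₁r hD₂r, one_mul, mul_comm]
    exact_mod_cast hD₂D₁
  obtain ⟨q, D', hq1, hXD', hqD, hfin⟩ := ih (n - 1) (by omega) (insert j I) (B.updateCol j v)
    (q₂ * (δ * q₀)) D₂ (by
      rw [compl_insert, card_erase_of_mem (by simpa using hjI), hn])
    (by rwa [← Matrix.cramer_apply]) (abs_updateCol_le hB hv j)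
    (Nat.mul_pos hq₂ (Nat.mul_pos hδ1 hq)) (by rwa [Nat.sub_add_cancel hnpos]) (by
      intro i hi r hr1 hrk
      obtain ⟨s, rfl⟩ : ∃ s, r = s + 1 := ⟨r - 1, by omega⟩
      by_cases hij : i = j
      · subst hij
        have h1 : (fun l => B.updateCol i v l i) = v := by
          ext l
          simp
        rw [h1]
        have h2 := (hnear (s + 1) hr1 hrk).nat_mul (q₂ ^ s)
        have h3 : ((q₂ * (δ * q₀) : ℕ) : ℝ) ^ (s + 1) * combCoeff a v (s + 1) =
            ((q₂ ^ s : ℕ) : ℝ) * (q₂ * (((δ * q₀ : ℕ) : ℝ) ^ (s + 1) *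
              combCoeff a v (s + 1))) := by
          push_cast
          ring
        rw [h3]
        refine h2.mono ?_
        push_cast
        calc (q₂ : ℝ) ^ s * ((X : ℝ) ^ C / (D₁ : ℝ) ^ (s + 1))
            ≤ ((X : ℝ) ^ C) ^ s * ((X : ℝ) ^ C / (D₁ : ℝ) ^ (s + 1)) := by gcongr
          _ = ((X : ℝ) ^ C / D₁) ^ (s + 1) := by
              rw [div_pow]
              ring
          _ ≤ _ := by gcongr
      · have hiI : i ∈ I := by
          rcases mem_insert.1 hi with h | h
          · exact absurd h hij
          · exact h
        have h1 : (fun l => B.updateCol j v l i) = fun l => B l i := by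
          ext l
          rw [Matrix.updateCol_ne hij]
        rw [h1]
        have h2 := (hI i hiI (s + 1) hr1 hrk).nat_mul ((q₂ * δ) ^ (s + 1))
        have h3 : ((q₂ * (δ * q₀) : ℕ) : ℝ) ^ (s + 1) * combCoeff a (fun l => B l i) (s + 1) =
            (((q₂ * δ) ^ (s + 1) : ℕ) : ℝ) *
              ((q₀ : ℝ) ^ (s + 1) * combCoeff a (fun l => B l i) (s + 1)) := by
          push_cast
          ring
        rw [h3]
        refine h2.mono ?_
        push_cast
        rw [← mul_pow]
        apply pow_le_pow_left₀ (by positivity)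
        rw [mul_one_div, div_le_div_iff₀ hDr hD₂r, one_mul]
        have : q₂ * δ * D₂ ≤ D := by
          calc q₂ * δ * D₂ ≤ X ^ C * δ * D₂ := by gcongr
            _ = δ * (D₂ * X ^ C) := by ring
            _ ≤ δ * D₁ := Nat.mul_le_mul_left _ hD₂D₁
            _ ≤ D := hXD₁
        exact_mod_cast this)
  refine ⟨q, D', hq1, hXD', hqD.trans ?_, hfin⟩
  calc q₂ * (δ * q₀) * D₂ ≤ X ^ C * (δ * q₀) * D₂ := by gcongr
    _ = q₀ * (δ * (D₂ * X ^ C)) := by ring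
    _ ≤ q₀ * (δ * D₁) := by gcongr
    _ ≤ q₀ * D := by gcongr

end Recurrence

/-- The squared norm of the geometric sum `∑ n < M, unitExp (n * x)`. -/
noncomputable def fejer (M : ℕ) (x : ℝ) : ℝ := ‖∑ n ∈ range M, unitExp (0 + n * x)‖ ^ 2

lemma fejer_nonneg (M : ℕ) (x : ℝ) : 0 ≤ fejer M x := sq_nonneg _

lemma fejer_mul_le (M : ℕ) (x : ℝ) : fejer M x * ‖unitExp x - 1‖ ^ 2 ≤ 4 := by
  have h := norm_sum_unitExp_linear_mul_le x 0 M
  rw [fejer, ← mul_pow]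
  calc _ ≤ (2 : ℝ) ^ 2 := pow_le_pow_left₀ (by positivity) h 2
    _ = 4 := by norm_num

lemma fejer_eq_sum (M : ℕ) (x : ℝ) : (fejer M x : ℂ) =
    ∑ p ∈ range M ×ˢ range M, unitExp ((((p.1 : ℤ) - p.2 : ℤ) : ℝ) * x) := by
  rw [fejer, Complex.ofReal_pow, ← Complex.mul_conj', map_sum, sum_mul_sum, sum_product]
  refine sum_congr rfl fun n _ => sum_congr rfl fun m _ => ?_
  rw [← unitExp_sub]
  congr 1
  push_cast
  ring

lemma diag_sum_eq (M : ℕ) (x : ℝ) : (M : ℂ) =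
    ∑ p ∈ (range M ×ˢ range M).filter (fun p => p.1 = p.2),
      unitExp ((((p.1 : ℤ) - p.2 : ℤ) : ℝ) * x) := by
  have h : ∀ p ∈ (range M ×ˢ range M).filter (fun p => p.1 = p.2),
      unitExp ((((p.1 : ℤ) - p.2 : ℤ) : ℝ) * x) = 1 := by
    intro p hp
    rw [mem_filter] at hp
    simp [hp.2, unitExp_zero]
  rw [sum_congr rfl h, sum_const, nsmul_eq_mul, mul_one]
  congr 1
  have : (range M ×ˢ range M).filter (fun p => p.1 = p.2) = (range M).diag := by
    ext p
    simp only [mem_filter, mem_product, mem_range, mem_diag]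
    constructor
    · rintro ⟨⟨h1, _⟩, h3⟩
      exact ⟨h1, h3⟩
    · rintro ⟨h1, h3⟩
      exact ⟨⟨h1, h3 ▸ h1⟩, h3⟩
  rw [this, diag_card, card_range]

lemma sum_mul_polyPhase {ι : Type*} [Fintype ι] (k : ℕ) (a : ι → ℕ → ℝ) (v : ι → ℤ) (q d : ℕ) :
    ∑ j, (v j : ℝ) * polyPhase k (a j) ((q * d : ℕ) : ℝ) =
      polyPhase k (fun r => (q : ℝ) ^ r * combCoeff a v r) d := by
  simp only [polyPhase, combCoeff, mul_sum, sum_mul]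
  rw [sum_comm]
  refine sum_congr rfl fun r _ => sum_congr rfl fun j _ => ?_
  push_cast
  ring

section Recurrence

variable {ι : Type*} [Fintype ι] [DecidableEq ι]

lemma sum_prod_eq_sum_piFinset (g : ι → ℕ → ℝ) (D : ℕ) (t : ι → Finset (ℕ × ℕ)) :
    ∑ d ∈ range D, ∏ j, ∑ p ∈ t j, unitExp ((((p.1 : ℤ) - p.2 : ℤ) : ℝ) * g j d) =
      ∑ p ∈ Fintype.piFinset t,
        ∑ d ∈ range D, unitExp (∑ j, ((((p j).1 : ℤ) - (p j).2 : ℤ) : ℝ) * g j d) := by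
  rw [sum_comm]
  refine sum_congr rfl fun d _ => ?_
  rw [prod_univ_sum]
  exact sum_congr rfl fun p _ => (unitExp_sum _ _).symm

/-- Passing to fewer frequencies increases the sum by a small amount only, when all exponential
sums have almost nonnegative real parts. -/
lemma re_sum_prod_le (g : ι → ℕ → ℝ) (D M : ℕ) {η : ℝ} (hη : 0 ≤ η)
    (hg : ∀ v : ι → ℤ, (∀ j, |v j| ≤ M) →
      -η ≤ (∑ d ∈ range D, unitExp (∑ j, (v j : ℝ) * g j d)).re)
    (t : ι → Finset (ℕ × ℕ)) (ht : ∀ j, t j ⊆ range M ×ˢ range M) :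
    (∑ d ∈ range D, ∏ j, ∑ p ∈ t j, unitExp ((((p.1 : ℤ) - p.2 : ℤ) : ℝ) * g j d)).re ≤
      ∑ d ∈ range D, ∏ j, fejer M (g j d) + (M : ℝ) ^ (2 * Fintype.card ι) * η := by
  have h1 : ((∑ d ∈ range D, ∏ j, fejer M (g j d) : ℝ) : ℂ) =
      ∑ d ∈ range D, ∏ j, ∑ p ∈ range M ×ˢ range M,
        unitExp ((((p.1 : ℤ) - p.2 : ℤ) : ℝ) * g j d) := by
    simp only [Complex.ofReal_sum, Complex.ofReal_prod]
    exact sum_congr rfl fun d _ => prod_congr rfl fun j _ => fejer_eq_sum M _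
  rw [sum_prod_eq_sum_piFinset g D (fun _ => range M ×ˢ range M)] at h1
  have h2 := congrArg Complex.re h1
  rw [Complex.ofReal_re] at h2
  rw [h2, sum_prod_eq_sum_piFinset, Complex.re_sum, Complex.re_sum]
  have hsub : Fintype.piFinset t ⊆ Fintype.piFinset (fun _ : ι => range M ×ˢ range M) :=
    Fintype.piFinset_subset _ _ ht
  rw [← sum_sdiff hsub]
  have hbound : ∀ p ∈ Fintype.piFinset (fun _ : ι => range M ×ˢ range M) \ Fintype.piFinset t,
      -η ≤ (∑ d ∈ range D, unitExp (∑ j, ((((p j).1 : ℤ) - (p j).2 : ℤ) : ℝ) * g j d)).re := by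
    intro p hp
    apply hg (fun j => ((p j).1 : ℤ) - (p j).2)
    intro j
    have := Fintype.mem_piFinset.1 (mem_sdiff.1 hp).1 j
    simp only [mem_product, mem_range] at this
    rw [abs_le]
    omega
  have h3 := card_nsmul_le_sum _ _ _ hbound
  have h4 : (#(Fintype.piFinset (fun _ : ι => range M ×ˢ range M) \ Fintype.piFinset t) : ℝ) ≤
      (M : ℝ) ^ (2 * Fintype.card ι) := by
    have h5 : #(Fintype.piFinset (fun _ : ι => range M ×ˢ range M) \ Fintype.piFinset t) ≤
        M ^ (2 * Fintype.card ι) := by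
      refine (card_le_card sdiff_subset).trans (le_of_eq ?_)
      rw [Fintype.card_piFinset, prod_const, card_univ, card_product, card_range, pow_mul, sq]
    exact_mod_cast h5
  rw [nsmul_eq_mul] at h3
  nlinarith

/-- If all bounded integer combinations of the functions `g j` have exponential sums with almost
nonnegative real parts, then the `g j` are simultaneously close to integers at some positive
argument. -/
lemma exists_sum_norm_sq_le [Nonempty ι] (g : ι → ℕ → ℝ) {D M : ℕ} (hM : 1 ≤ M)
    (hDM : 8 * M ^ Fintype.card ι ≤ D) {η : ℝ} (hη : 0 ≤ η)
    (hηM : 8 * (M : ℝ) ^ Fintype.card ι * η ≤ D)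
    (hg : ∀ v : ι → ℤ, (∀ j, |v j| ≤ M) →
      -η ≤ (∑ d ∈ range D, unitExp (∑ j, (v j : ℝ) * g j d)).re) :
    ∃ d, 1 ≤ d ∧ d < D ∧
      ∑ j, ‖unitExp (g j d) - 1‖ ^ 2 ≤ 8 * Fintype.card ι / M := by
  have hMr : (1 : ℝ) ≤ M := by exact_mod_cast hM
  have hDpos : 0 < D := lt_of_lt_of_le (by positivity) hDM
  have hDr : (0 : ℝ) < D := by exact_mod_cast hDpos
  set m : ℝ := (M : ℝ) ^ Fintype.card ι with hm
  have hm1 : 1 ≤ m := one_le_pow₀ hMr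
  have hDMr : 8 * m ≤ D := by
    rw [hm]
    exact_mod_cast hDM
  have hm2 : (M : ℝ) ^ (2 * Fintype.card ι) = m * m := by rw [hm, two_mul, pow_add]
  set w : ℕ → ℝ := fun d => ∏ j, fejer M (g j d) with hw
  have hw0 : ∀ d, 0 ≤ w d := fun d => prod_nonneg fun j _ => fejer_nonneg _ _
  have hfej : ∀ x, fejer M x ≤ (M : ℝ) ^ 2 := by
    intro x
    apply pow_le_pow_left₀ (norm_nonneg _)
    refine (norm_sum_le _ _).trans ?_
    simp [norm_unitExp]
  set W := ∑ d ∈ Ico 1 D, w d with hW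
  have hsplit : ∑ d ∈ range D, w d = w 0 + W := by
    rw [range_eq_Ico, sum_eq_sum_Ico_succ_bot hDpos]
  have hw0le : w 0 ≤ m * m := by
    calc w 0 ≤ ∏ j : ι, (M : ℝ) ^ 2 := prod_le_prod (fun j _ => fejer_nonneg _ _) fun j _ => hfej _
      _ = m * m := by rw [prod_const, card_univ, ← pow_mul, hm2]
  set diag : Finset (ℕ × ℕ) := (range M ×ˢ range M).filter (fun p => p.1 = p.2) with hdiag
  have hWlow : (3 / 4) * (m * D) ≤ W := by
    have h1 := re_sum_prod_le g D M hη hg (fun _ => diag) (fun _ => filter_subset _ _)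
    rw [sum_congr rfl fun d _ => prod_congr rfl fun j _ => (diag_sum_eq M (g j d)).symm] at h1
    have h2 : (∑ d ∈ range D, ∏ _j : ι, (M : ℂ)) = ((D * m : ℝ) : ℂ) := by
      simp [hm]
    rw [h2, Complex.ofReal_re, hsplit, hm2] at h1
    nlinarith
  have hWj : ∀ j, M * ∑ d ∈ Ico 1 D, ∏ i ∈ univ.erase j, fejer M (g i d) ≤ 2 * W := by
    intro j
    have h1 := re_sum_prod_le g D M hη hg
      (fun i => if i = j then diag else range M ×ˢ range M) (fun i => by
        split_ifs
        · exact filter_subset _ _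
        · exact Subset.rfl)
    have h2 : (∑ d ∈ range D, ∏ i, ∑ p ∈ (if i = j then diag else range M ×ˢ range M),
        unitExp ((((p.1 : ℤ) - p.2 : ℤ) : ℝ) * g i d)) =
        ((M * ∑ d ∈ range D, ∏ i ∈ univ.erase j, fejer M (g i d) : ℝ) : ℂ) := by
      simp only [Complex.ofReal_sum, Complex.ofReal_prod, Complex.ofReal_mul,
        Complex.ofReal_natCast]
      rw [mul_sum]
      refine sum_congr rfl fun d _ => ?_
      rw [← mul_prod_erase univ _ (mem_univ j), if_pos rfl, ← diag_sum_eq]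
      congr 1
      refine prod_congr rfl fun i hi => ?_
      rw [if_neg (ne_of_mem_erase hi), fejer_eq_sum]
    rw [h2, Complex.ofReal_re, hsplit, hm2] at h1
    have h3 : ∑ d ∈ Ico 1 D, ∏ i ∈ univ.erase j, fejer M (g i d) ≤
        ∑ d ∈ range D, ∏ i ∈ univ.erase j, fejer M (g i d) := by
      apply sum_le_sum_of_subset_of_nonneg
      · rw [range_eq_Ico]
        exact Ico_subset_Ico (by norm_num) le_rfl
      · exact fun d _ _ => prod_nonneg fun i _ => fejer_nonneg _ _
    nlinarith
  by_contra hcon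
  push Not at hcon
  have hWpos : 0 < W := lt_of_lt_of_le (by positivity) hWlow
  have hM0 : (0 : ℝ) < M := by linarith
  have h1 : ∑ d ∈ Ico 1 D, w d * (8 * Fintype.card ι / M) <
      ∑ d ∈ Ico 1 D, w d * ∑ j, ‖unitExp (g j d) - 1‖ ^ 2 := by
    obtain ⟨d, hd, hwd⟩ := exists_lt_of_sum_lt (s := Ico 1 D) (f := fun _ => (0 : ℝ)) (g := w)
      (by simpa using hWpos)
    refine sum_lt_sum (fun d hd => ?_) ⟨d, hd, ?_⟩
    · rw [mem_Ico] at hd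
      exact mul_le_mul_of_nonneg_left (hcon d hd.1 hd.2).le (hw0 d)
    · rw [mem_Ico] at hd
      exact mul_lt_mul_of_pos_left (hcon d hd.1 hd.2) hwd
  have h2 : ∑ d ∈ Ico 1 D, w d * ∑ j, ‖unitExp (g j d) - 1‖ ^ 2 ≤
      ∑ j : ι, 4 * ∑ d ∈ Ico 1 D, ∏ i ∈ univ.erase j, fejer M (g i d) := by
    simp only [mul_sum]
    rw [sum_comm]
    refine sum_le_sum fun j _ => sum_le_sum fun d _ => ?_
    rw [hw]
    dsimp only
    rw [← mul_prod_erase univ _ (mem_univ j)]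
    have h3 := fejer_mul_le M (g j d)
    have h4 : 0 ≤ ∏ i ∈ univ.erase j, fejer M (g i d) :=
      prod_nonneg fun i _ => fejer_nonneg _ _
    nlinarith
  have h3 : ∑ j : ι, 4 * ∑ d ∈ Ico 1 D, ∏ i ∈ univ.erase j, fejer M (g i d) ≤
      ∑ j : ι, W * (8 / M) := by
    refine sum_le_sum fun j _ => ?_
    rw [← mul_div_assoc, le_div_iff₀ hM0]
    linarith [hWj j]
  rw [← sum_mul] at h1
  rw [sum_const, card_univ, nsmul_eq_mul] at h3
  have h4 : W * (8 * Fintype.card ι / M) = Fintype.card ι * (W * (8 / M)) := by ring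
  linarith

end Recurrence

/-- Simultaneous polynomial recurrence: finitely many real polynomials without constant term are
simultaneously close to integers, on average, at some positive integer which is not too large in
terms of the number of polynomials. -/
theorem exists_polynomial_recurrence (k : ℕ) : ∃ E : ℕ, ∀ {ι : Type} [Fintype ι] [DecidableEq ι]
    [Nonempty ι] (a : ι → ℕ → ℝ) (M X : ℕ), (∀ j, a j 0 = 0) → 1 ≤ M →
    8 * Fintype.card ι * ((Fintype.card ι).factorial * M ^ Fintype.card ι) ≤ X →
    ∃ d : ℕ, 1 ≤ d ∧ d ≤ X ^ (E * (Fintype.card ι + 1)) ∧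
      ∑ j, ‖unitExp (polyPhase k (a j) d) - 1‖ ^ 2 ≤ 8 * Fintype.card ι / M := by
  obtain ⟨E, hE⟩ := exists_modulus_of_basis k
  refine ⟨E, ?_⟩
  intro ι _ _ _ a M X ha hM hX
  have hc : 1 ≤ Fintype.card ι := Fintype.card_pos
  have hf : 1 ≤ (Fintype.card ι).factorial := Nat.factorial_pos _
  have hMp : 1 ≤ M ^ Fintype.card ι := Nat.one_le_pow _ _ hM
  have hfM : 1 * M ^ Fintype.card ι ≤ (Fintype.card ι).factorial * M ^ Fintype.card ι :=
    Nat.mul_le_mul_right _ hf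
  have hcf : 1 * ((Fintype.card ι).factorial * M ^ Fintype.card ι) ≤
      Fintype.card ι * ((Fintype.card ι).factorial * M ^ Fintype.card ι) :=
    Nat.mul_le_mul_right _ hc
  rw [mul_assoc] at hX
  have hX8 : 8 * M ^ Fintype.card ι ≤ X := by omega
  have hX0 : (0 : ℝ) < X := by exact_mod_cast (by omega : 0 < X)
  obtain ⟨q, D, hq, hXD, hqD, hfin⟩ := hE a M X ha (by omega) (by omega) (by omega)
    (Fintype.card ι) ∅ 1 1 (X ^ (E * (Fintype.card ι + 1))) (by simp) (by simp) (by
      intro i j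
      rw [Matrix.one_apply]
      split_ifs
      · simpa using hM
      · simp) le_rfl le_rfl (by simp)
  obtain ⟨d, hd1, hdD, hd⟩ := exists_sum_norm_sq_le
    (fun j d => polyPhase k (a j) ((q * d : ℕ) : ℝ)) (D := D) hM (hX8.trans hXD)
    (η := D / X) (by positivity) (by
      rw [← mul_div_assoc, div_le_iff₀ hX0, mul_comm]
      have : 8 * (M : ℝ) ^ Fintype.card ι ≤ X := by exact_mod_cast hX8
      gcongr) (by
      intro v hv
      have h := hfin v hv
      rwa [sum_congr rfl fun d _ => congrArg unitExp (sum_mul_polyPhase k a v q d).symm] at h)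
  refine ⟨q * d, Nat.mul_pos hq hd1, ?_, hd⟩
  calc q * d ≤ q * D := Nat.mul_le_mul_left _ hdD.le
    _ ≤ _ := hqD.trans (by rw [one_mul])

lemma sum_unitExp_mul_div {n : ℕ} (t : ℤ) (ht : |t| < n) :
    ∑ m ∈ range n, unitExp (t * m / n) = if t = 0 then (n : ℂ) else 0 := by
  split_ifs with h0
  · subst h0
    simp [unitExp_zero]
  have hn : 0 < (n : ℤ) := (abs_nonneg t).trans_lt ht
  have hnr : (0 : ℝ) < n := by exact_mod_cast hn
  have h1 : ∑ m ∈ range n, unitExp (t * m / n) = ∑ m ∈ range n, unitExp (t / n) ^ m := by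
    refine sum_congr rfl fun m _ => ?_
    rw [← unitExp_nat_mul]
    congr 1
    ring
  have h2 : unitExp (t / n) ^ n = 1 := by
    rw [← unitExp_nat_mul, mul_div_cancel₀ _ hnr.ne', unitExp_int]
  have h3 : unitExp (t / n) - 1 ≠ 0 := by
    intro h
    obtain ⟨z, hz⟩ := nearInt_norm_unitExp_sub_one (t / n)
    rw [h, norm_zero, zero_div] at hz
    have h4 : (t : ℝ) / n = z := sub_eq_zero.1 (abs_nonpos_iff.1 hz)
    rw [div_eq_iff hnr.ne'] at h4
    have h5 : t = z * n := by exact_mod_cast h4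
    exact h0 (Int.eq_zero_of_abs_lt_dvd ⟨z, by rw [h5, mul_comm]⟩ ht)
  rw [h1]
  refine (mul_eq_zero.1 ?_).resolve_right h3
  rw [geom_sum_mul, h2, sub_self]

/-- Parseval's identity for exponential sums with distinct frequencies modulo `n`. -/
lemma sum_norm_sq_sum_unitExp {κ : Type*} {n : ℕ} (S : Finset κ) (s : κ → ℤ) (c : κ → ℂ)
    (hs : ∀ i ∈ S, ∀ j ∈ S, |s i - s j| < n) (hinj : Set.InjOn s S) :
    ∑ m ∈ range n, ‖∑ i ∈ S, c i * unitExp (s i * m / n)‖ ^ 2 = n * ∑ i ∈ S, ‖c i‖ ^ 2 := by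
  classical
  have h : ((∑ m ∈ range n, ‖∑ i ∈ S, c i * unitExp (s i * m / n)‖ ^ 2 : ℝ) : ℂ) =
      ((n * ∑ i ∈ S, ‖c i‖ ^ 2 : ℝ) : ℂ) := by
    simp only [Complex.ofReal_sum, Complex.ofReal_pow, Complex.ofReal_mul, Complex.ofReal_natCast,
      ← Complex.mul_conj']
    have h1 : ∀ m, (∑ i ∈ S, c i * unitExp (s i * m / n)) *
        starRingEnd ℂ (∑ i ∈ S, c i * unitExp (s i * m / n)) =
        ∑ i ∈ S, ∑ j ∈ S, c i * starRingEnd ℂ (c j) * unitExp ((s i - s j : ℤ) * m / n) := by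
      intro m
      rw [map_sum, sum_mul_sum]
      refine sum_congr rfl fun i _ => sum_congr rfl fun j _ => ?_
      have : (((s i - s j : ℤ) : ℝ) * m / n) = s i * m / n - s j * m / n := by
        push_cast
        ring
      rw [this, unitExp_sub, map_mul]
      ring
    have h1' : ∀ m ∈ range n, (∑ i ∈ S, c i * unitExp (s i * m / n)) *
        starRingEnd ℂ (∑ i ∈ S, c i * unitExp (s i * m / n)) =
        ∑ i ∈ S, ∑ j ∈ S, c i * starRingEnd ℂ (c j) * unitExp ((s i - s j : ℤ) * m / n) :=
      fun m _ => h1 m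
    rw [sum_congr rfl h1', sum_comm, mul_sum]
    refine sum_congr rfl fun i hi => ?_
    rw [sum_comm]
    have h2 : ∀ j ∈ S, ∑ m ∈ range n,
        c i * starRingEnd ℂ (c j) * unitExp ((s i - s j : ℤ) * m / n) =
        if i = j then c i * starRingEnd ℂ (c j) * n else 0 := by
      intro j hj
      rw [← mul_sum, sum_unitExp_mul_div _ (hs i hi j hj)]
      by_cases hij : i = j
      · simp [hij]
      · have : s i - s j ≠ 0 := fun h => hij (hinj hi hj (sub_eq_zero.1 h))
        simp [hij, this]
    rw [sum_congr rfl h2, sum_ite_eq, if_pos hi]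
    ring
  exact_mod_cast h

/-- The exponential sum over `A` with frequency `r / n`. -/
noncomputable def expSum (n : ℕ) (A : Finset ℤ) (r : ℕ) : ℂ := ∑ a ∈ A, unitExp (a * r / n)

lemma norm_expSum_le (n : ℕ) (A : Finset ℤ) (r : ℕ) : ‖expSum n A r‖ ≤ #A := by
  refine (norm_sum_le _ _).trans ?_
  simp [norm_unitExp]

lemma sum_norm_sq_expSum {n N : ℕ} {A : Finset ℤ} (hA : A ⊆ Icc 1 (N : ℤ)) (hN : N ≤ n) :
    ∑ r ∈ range n, ‖expSum n A r‖ ^ 2 = n * #A := by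
  have h := sum_norm_sq_sum_unitExp (n := n) A id (fun _ => 1) (by
    intro i hi j hj
    have h1 := mem_Icc.1 (hA hi)
    have h2 := mem_Icc.1 (hA hj)
    rw [id, id, abs_lt]
    omega) Function.injective_id.injOn
  simpa [expSum] using h

/-- The number of representations of `m` as a sum of an element of `A` and one of `B`. -/
def addRep (A B : Finset ℤ) (m : ℤ) : ℕ := #{p ∈ A ×ˢ B | p.1 + p.2 = m}

lemma addRep_eq_sum {N : ℕ} {A B : Finset ℤ} (hA : A ⊆ Icc 1 (N : ℤ)) (hB : B ⊆ Icc 1 (N : ℤ))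
    {m : ℤ} (hm : -N ≤ m) (hm' : m ≤ 3 * N) :
    (((4 * N : ℕ) : ℂ)) * addRep A B m = ∑ r ∈ range (4 * N), starRingEnd ℂ
      (expSum (4 * N) A r * expSum (4 * N) B r) * unitExp (r * m / (4 * N : ℕ)) := by
  have h1 : ∀ r ∈ range (4 * N), starRingEnd ℂ
      (expSum (4 * N) A r * expSum (4 * N) B r) * unitExp (r * m / (4 * N : ℕ)) =
      ∑ p ∈ A ×ˢ B, unitExp ((m - (p.1 + p.2) : ℤ) * r / (4 * N : ℕ)) := by
    intro r _
    rw [expSum, expSum, sum_mul_sum, ← sum_product', map_sum, sum_mul]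
    refine sum_congr rfl fun p _ => ?_
    rw [← unitExp_add, ← unitExp_neg, ← unitExp_add]
    congr 1
    push_cast
    ring
  rw [sum_congr rfl h1, sum_comm]
  have h2 : ∀ p ∈ A ×ˢ B, ∑ r ∈ range (4 * N), unitExp ((m - (p.1 + p.2) : ℤ) * r / (4 * N : ℕ)) =
      if p.1 + p.2 = m then ((4 * N : ℕ) : ℂ) else 0 := by
    intro p hp
    rw [mem_product] at hp
    have ha := mem_Icc.1 (hA hp.1)
    have hb := mem_Icc.1 (hB hp.2)
    rw [sum_unitExp_mul_div _ (by rw [abs_lt]; push_cast; omega)]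
    congr 1
    exact propext (sub_eq_zero.trans eq_comm)
  rw [sum_congr rfl h2, ← sum_filter, sum_const, addRep, nsmul_eq_mul, mul_comm]

/-- The `L²` distance between the representation function and its translate, in terms of the
exponential sums. -/
lemma sum_sq_addRep_sub_le {N : ℕ} {A B : Finset ℤ} (hA : A ⊆ Icc 1 (N : ℤ))
    (hB : B ⊆ Icc 1 (N : ℤ)) (hN : 1 ≤ N) {t : ℤ} (ht : |t| ≤ N) :
    (4 * N : ℕ) * ∑ m ∈ range (2 * N + 1), ((addRep A B m : ℝ) - addRep A B (m + t)) ^ 2 ≤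
      ∑ r ∈ range (4 * N), ‖expSum (4 * N) A r‖ ^ 2 * ‖expSum (4 * N) B r‖ ^ 2 *
        ‖unitExp (t * r / (4 * N : ℕ)) - 1‖ ^ 2 := by
  rw [abs_le] at ht
  set n := 4 * N with hn
  have hnr : (0 : ℝ) < n := by exact_mod_cast (by omega)
  set c : ℕ → ℂ := fun r => starRingEnd ℂ (expSum n A r * expSum n B r) *
    (1 - unitExp (t * r / n)) with hc
  have hpars := sum_norm_sq_sum_unitExp (n := n) (range n) (fun r => (r : ℤ)) c (by
    intro i hi j hj
    rw [mem_range] at hi hj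
    rw [abs_lt]
    omega) (fun i _ j _ h => by simpa using h)
  have h1 : ∀ m ∈ range (2 * N + 1),
      (n : ℝ) ^ 2 * ((addRep A B m : ℝ) - addRep A B (m + t)) ^ 2 =
      ‖∑ r ∈ range n, c r * unitExp (((r : ℤ) : ℝ) * m / n)‖ ^ 2 := by
    intro m hm
    rw [mem_range] at hm
    have h2 : ∑ r ∈ range n, c r * unitExp (((r : ℤ) : ℝ) * m / n) =
        (((n : ℝ) * ((addRep A B m : ℝ) - addRep A B (m + t)) : ℝ) : ℂ) := by
      have h3 := addRep_eq_sum hA hB (m := (m : ℤ)) (by omega) (by omega)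
      have h4 := addRep_eq_sum hA hB (m := (m : ℤ) + t) (by omega) (by omega)
      rw [← hn] at h3 h4
      simp only [Complex.ofReal_mul, Complex.ofReal_sub, Complex.ofReal_natCast]
      rw [mul_sub, h3, h4, ← sum_sub_distrib]
      refine sum_congr rfl fun r _ => ?_
      have h5 : unitExp (r * ((m + t : ℤ) : ℝ) / n) =
          unitExp (r * ((m : ℤ) : ℝ) / n) * unitExp (t * r / n) := by
        rw [← unitExp_add]
        congr 1
        push_cast
        ring
      rw [h5, hc]
      simp only [Int.cast_natCast]
      ring
    rw [h2, Complex.norm_real, Real.norm_eq_abs, sq_abs, mul_pow]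
  have h6 : (n : ℝ) ^ 2 * ∑ m ∈ range (2 * N + 1),
      ((addRep A B m : ℝ) - addRep A B (m + t)) ^ 2 ≤ n * ∑ r ∈ range n, ‖c r‖ ^ 2 := by
    rw [mul_sum, sum_congr rfl h1, ← hpars]
    apply sum_le_sum_of_subset_of_nonneg
    · intro m hm
      rw [mem_range] at hm ⊢
      omega
    · exact fun _ _ _ => sq_nonneg _
  have h7 : ∀ r ∈ range n, ‖c r‖ ^ 2 = ‖expSum n A r‖ ^ 2 * ‖expSum n B r‖ ^ 2 *
      ‖unitExp (t * r / n) - 1‖ ^ 2 := by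
    intro r _
    rw [hc]
    dsimp only
    rw [norm_mul, RCLike.norm_conj, norm_mul, norm_sub_rev, mul_pow, mul_pow]
  rw [sum_congr rfl h7, sq, mul_assoc] at h6
  exact le_of_mul_le_mul_left h6 hnr

/-- If the shifts `t i` nearly fix, on average, the large Fourier coefficients of `A`, then some
translate of the set of shifts is contained in `A + B`. -/
lemma exists_translate_subset_add {ℓ N M : ℕ} (hℓ : 1 ≤ ℓ) (hN : 1 ≤ N) {A B : Finset ℤ}
    (hA : A ⊆ Icc 1 (N : ℤ)) (hB : B ⊆ Icc 1 (N : ℤ)) (hA0 : A.Nonempty) (hB0 : B.Nonempty)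
    {R : Finset ℕ} (hR : R = {r ∈ range (4 * N) |
      (#A : ℝ) ^ 2 * #B ≤ 32 * ℓ ^ 2 * N * ‖expSum (4 * N) A r‖ ^ 2})
    (hM : M = 12 * ℓ * (ℓ * #R)) (t : Fin ℓ → ℤ) (ht : ∀ i, |t i| ≤ N)
    (hrec : ∑ i, ∑ r ∈ R, ‖unitExp (t i * r / (4 * N : ℕ)) - 1‖ ^ 2 ≤
      8 * (ℓ * #R : ℕ) / (M : ℝ)) :
    ∃ m : ℤ, 2 ≤ m ∧ m ≤ 2 * N ∧ ∀ i, m + t i ∈ A + B := by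
  have hℓr : (1 : ℝ) ≤ ℓ := by exact_mod_cast hℓ
  have hNr : (1 : ℝ) ≤ N := by exact_mod_cast hN
  have hAr : (1 : ℝ) ≤ #A := by exact_mod_cast hA0.card_pos
  have hBr : (1 : ℝ) ≤ #B := by exact_mod_cast hB0.card_pos
  by_contra hcon
  push Not at hcon
  set f : ℤ → ℝ := fun m => addRep A B m with hf
  have hf0 : ∀ m, 0 ≤ f m := fun m => Nat.cast_nonneg _
  have hfz : ∀ m, m ∉ A + B → f m = 0 := by
    intro m hm
    rw [hf]
    dsimp only
    rw [Nat.cast_eq_zero, addRep, card_eq_zero, filter_eq_empty_iff]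
    intro p hp hpm
    rw [mem_product] at hp
    exact hm (hpm ▸ add_mem_add hp.1 hp.2)
  have hmass : ∑ m ∈ range (2 * N + 1), f m = #A * #B := by
    have h1 : #(A ×ˢ B) = ∑ m ∈ range (2 * N + 1), #{p ∈ A ×ˢ B | (p.1 + p.2).toNat = m} := by
      apply card_eq_sum_card_fiberwise
      intro p hp
      have hp := mem_product.1 hp
      have ha := mem_Icc.1 (hA hp.1)
      have hb := mem_Icc.1 (hB hp.2)
      have h2 : (p.1 + p.2).toNat < 2 * N + 1 := by omega
      simpa using h2
    have h2 : ∀ m ∈ range (2 * N + 1), #{p ∈ A ×ˢ B | (p.1 + p.2).toNat = m} = addRep A B m := by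
      intro m _
      rw [addRep]
      congr 1
      refine filter_congr fun p hp => ?_
      rw [mem_product] at hp
      have ha := mem_Icc.1 (hA hp.1)
      have hb := mem_Icc.1 (hB hp.2)
      omega
    rw [sum_congr rfl h2, card_product] at h1
    have h3 : ((∑ m ∈ range (2 * N + 1), addRep A B m : ℕ) : ℝ) = (#A * #B : ℕ) :=
      congrArg _ h1.symm
    rw [Nat.cast_sum, Nat.cast_mul] at h3
    exact h3
  have hle : ∀ m ∈ range (2 * N + 1), f m ≤ ∑ i, |f m - f (m + t i)| := by
    intro m hm
    rw [mem_range] at hm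
    by_cases hmA : (m : ℤ) ∈ A + B
    · obtain ⟨a, ha, b, hb, hab⟩ := mem_add.1 hmA
      have ha := mem_Icc.1 (hA ha)
      have hb := mem_Icc.1 (hB hb)
      obtain ⟨i, hi⟩ := hcon m (by omega) (by omega)
      have h1 : |f m - f (m + t i)| = f m := by
        rw [hfz _ hi, sub_zero, abs_of_nonneg (hf0 _)]
      calc f m = |f m - f (m + t i)| := h1.symm
        _ ≤ _ := single_le_sum (f := fun i => |f m - f (m + t i)|) (fun _ _ => abs_nonneg _)
          (mem_univ i)
    · rw [hfz _ hmA]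
      exact sum_nonneg fun _ _ => abs_nonneg _
  set V := ∑ i, ∑ m ∈ range (2 * N + 1), (f m - f (m + t i)) ^ 2 with hV
  have hV1 : ((#A : ℝ) * #B) ^ 2 ≤ ℓ * (3 * N) * V := by
    have h1 : (#A : ℝ) * #B ≤ ∑ x ∈ univ ×ˢ range (2 * N + 1), |f x.2 - f (x.2 + t x.1)| := by
      rw [sum_product, sum_comm, ← hmass]
      exact sum_le_sum hle
    have h2 := sq_sum_le_card_mul_sum_sq (s := univ ×ˢ range (2 * N + 1))
      (f := fun x : Fin ℓ × ℕ => |f x.2 - f (x.2 + t x.1)|)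
    simp only [sq_abs] at h2
    have hVeq : ∑ x ∈ (univ : Finset (Fin ℓ)) ×ˢ range (2 * N + 1),
        (f x.2 - f (x.2 + t x.1)) ^ 2 = V := by
      rw [sum_product]
    rw [hVeq, card_product, card_range, card_univ, Fintype.card_fin] at h2
    refine (pow_le_pow_left₀ (by positivity) h1 2).trans (h2.trans ?_)
    have h3 : ((ℓ * (2 * N + 1) : ℕ) : ℝ) ≤ ℓ * (3 * N) := by
      push_cast
      gcongr
      linarith
    have h4 : 0 ≤ V := sum_nonneg fun i _ => sum_nonneg fun m _ => sq_nonneg _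
    exact mul_le_mul_of_nonneg_right h3 h4
  have hRne : 0 ∈ R := by
    rw [hR, mem_filter, mem_range]
    refine ⟨by omega, ?_⟩
    have h1 : expSum (4 * N) A 0 = #A := by simp [expSum, unitExp_zero]
    have hBN : (#B : ℝ) ≤ N := by
      have := card_le_card hB
      rw [Int.card_Icc] at this
      exact_mod_cast (by omega : #B ≤ N)
    rw [h1, Complex.norm_natCast]
    have h2 : (1 : ℝ) ≤ ℓ ^ 2 := one_le_pow₀ hℓr
    have h3 : (#B : ℝ) ≤ 32 * ℓ ^ 2 * N := by nlinarith
    calc (#A : ℝ) ^ 2 * #B ≤ (#A : ℝ) ^ 2 * (32 * ℓ ^ 2 * N) := by gcongr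
      _ = _ := by ring
  have hRr : (1 : ℝ) ≤ #R := by exact_mod_cast card_pos.2 ⟨0, hRne⟩
  have hrec' : ∑ i, ∑ r ∈ R, ‖unitExp (t i * r / (4 * N : ℕ)) - 1‖ ^ 2 ≤ 2 / (3 * ℓ) := by
    refine hrec.trans (le_of_eq ?_)
    rw [hM]
    push_cast
    field_simp
    norm_num
  have hRsub : R ⊆ range (4 * N) := hR ▸ filter_subset _ _
  have hi : ∀ i, 4 * N * ∑ m ∈ range (2 * N + 1), (f m - f (m + t i)) ^ 2 ≤
      (#A : ℝ) ^ 2 * (#B : ℝ) ^ 2 * ∑ r ∈ R, ‖unitExp (t i * r / (4 * N : ℕ)) - 1‖ ^ 2 +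
      (#A : ℝ) ^ 2 * (#B : ℝ) ^ 2 / (2 * ℓ ^ 2) := by
    intro i
    have h1 := sum_sq_addRep_sub_le hA hB hN (ht i)
    rw [← sum_sdiff hRsub] at h1
    push_cast at h1 ⊢
    refine (h1.trans (add_le_add ?_ ?_)).trans (le_of_eq (add_comm _ _))
    · have h4 : ∀ r ∈ range (4 * N) \ R, ‖expSum (4 * N) A r‖ ^ 2 * ‖expSum (4 * N) B r‖ ^ 2 *
          ‖unitExp (t i * r / (4 * N)) - 1‖ ^ 2 ≤
          (#A : ℝ) ^ 2 * #B / (8 * ℓ ^ 2 * N) * ‖expSum (4 * N) B r‖ ^ 2 := by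
        intro r hr
        rw [mem_sdiff, hR, mem_filter] at hr
        have h5 : 32 * ℓ ^ 2 * N * ‖expSum (4 * N) A r‖ ^ 2 ≤ (#A : ℝ) ^ 2 * #B := by
          by_contra h
          push Not at h
          exact hr.2 ⟨hr.1, h.le⟩
        have h6 : ‖unitExp (t i * r / (4 * N)) - 1‖ ^ 2 ≤ 4 := by
          have h7 : ‖unitExp (t i * r / (4 * N)) - 1‖ ≤ 2 := by
            refine (norm_sub_le _ _).trans ?_
            rw [norm_unitExp]
            norm_num
          nlinarith [norm_nonneg (unitExp (t i * r / (4 * N)) - 1)]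
        have h8 : ‖expSum (4 * N) A r‖ ^ 2 * 4 ≤ (#A : ℝ) ^ 2 * #B / (8 * ℓ ^ 2 * N) := by
          rw [le_div_iff₀ (by positivity)]
          linarith
        calc ‖expSum (4 * N) A r‖ ^ 2 * ‖expSum (4 * N) B r‖ ^ 2 *
            ‖unitExp (t i * r / (4 * N)) - 1‖ ^ 2
            ≤ ‖expSum (4 * N) A r‖ ^ 2 * ‖expSum (4 * N) B r‖ ^ 2 * 4 := by gcongr
          _ = ‖expSum (4 * N) A r‖ ^ 2 * 4 * ‖expSum (4 * N) B r‖ ^ 2 := by ring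
          _ ≤ _ := by gcongr
      refine (sum_le_sum h4).trans ?_
      rw [← mul_sum]
      have h9 : ∑ r ∈ range (4 * N) \ R, ‖expSum (4 * N) B r‖ ^ 2 ≤ 4 * N * #B := by
        have := sum_norm_sq_expSum hB (by omega : N ≤ 4 * N)
        push_cast at this
        rw [← this]
        exact sum_le_sum_of_subset_of_nonneg sdiff_subset fun _ _ _ => sq_nonneg _
      calc (#A : ℝ) ^ 2 * #B / (8 * ℓ ^ 2 * N) * ∑ r ∈ range (4 * N) \ R, ‖expSum (4 * N) B r‖ ^ 2
          ≤ (#A : ℝ) ^ 2 * #B / (8 * ℓ ^ 2 * N) * (4 * N * #B) := by gcongr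
        _ = _ := by
            field_simp
            norm_num
    · rw [mul_sum]
      refine sum_le_sum fun r _ => ?_
      have h2 := norm_expSum_le (4 * N) A r
      have h3 := norm_expSum_le (4 * N) B r
      gcongr
  have hsum : 4 * N * V ≤ (#A : ℝ) ^ 2 * (#B : ℝ) ^ 2 * (2 / (3 * ℓ)) +
      ℓ * ((#A : ℝ) ^ 2 * (#B : ℝ) ^ 2 / (2 * ℓ ^ 2)) := by
    rw [hV, mul_sum]
    refine (sum_le_sum fun i _ => hi i).trans ?_
    rw [sum_add_distrib, ← mul_sum, sum_const, card_univ, Fintype.card_fin, nsmul_eq_mul]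
    gcongr
  have h1 : (#A : ℝ) ^ 2 * (#B : ℝ) ^ 2 * (2 / (3 * ℓ)) +
      ℓ * ((#A : ℝ) ^ 2 * (#B : ℝ) ^ 2 / (2 * ℓ ^ 2)) =
      (7 / 6) * ((#A : ℝ) * #B) ^ 2 / ℓ := by
    field_simp
    norm_num
  rw [h1, le_div_iff₀ (by linarith)] at hsum
  have h2 : 0 < ((#A : ℝ) * #B) ^ 2 := by positivity
  nlinarith

/-- The sum of the absolute values of the coefficients of degree at most `k`. -/
def coeffNorm (k : ℕ) (p : Polynomial ℤ) : ℕ := ∑ s ∈ range (k + 1), (p.coeff s).natAbs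

lemma abs_eval_le {k : ℕ} {p : Polynomial ℤ} (hp : p.natDegree ≤ k) {d : ℕ} (hd : 1 ≤ d) :
    |p.eval (d : ℤ)| ≤ (coeffNorm k p * d ^ k : ℕ) := by
  rw [Polynomial.eval_eq_sum_range' (Nat.lt_succ_of_le hp), coeffNorm]
  refine (abs_sum_le_sum_abs _ _).trans ?_
  push_cast
  rw [sum_mul]
  refine sum_le_sum fun s hs => ?_
  rw [abs_mul, abs_pow, Nat.abs_cast]
  have h : (d : ℤ) ^ s ≤ d ^ k :=
    pow_le_pow_right₀ (by exact_mod_cast hd) (Nat.lt_succ_iff.1 (mem_range.1 hs))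
  gcongr

lemma card_large_expSum_mul_le {ℓ N : ℕ} (hN : 1 ≤ N) {A B : Finset ℤ}
    (hA : A ⊆ Icc 1 (N : ℤ)) (hA0 : A.Nonempty) :
    (#{r ∈ range (4 * N) | (#A : ℝ) ^ 2 * #B ≤ 32 * ℓ ^ 2 * N * ‖expSum (4 * N) A r‖ ^ 2} : ℝ) *
      (#A * #B) ≤ 128 * ℓ ^ 2 * N ^ 2 := by
  set R : Finset ℕ := {r ∈ range (4 * N) |
    (#A : ℝ) ^ 2 * #B ≤ 32 * ℓ ^ 2 * N * ‖expSum (4 * N) A r‖ ^ 2} with hR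
  have hAr : (0 : ℝ) < #A := by exact_mod_cast hA0.card_pos
  have h1 : (#R : ℝ) * ((#A : ℝ) ^ 2 * #B) ≤
      32 * ℓ ^ 2 * N * ∑ r ∈ range (4 * N), ‖expSum (4 * N) A r‖ ^ 2 := by
    rw [mul_sum, ← nsmul_eq_mul, ← sum_const]
    calc ∑ _r ∈ R, (#A : ℝ) ^ 2 * #B
        ≤ ∑ r ∈ R, 32 * ℓ ^ 2 * N * ‖expSum (4 * N) A r‖ ^ 2 :=
          sum_le_sum fun r hr => (mem_filter.1 hr).2
      _ ≤ _ := sum_le_sum_of_subset_of_nonneg (filter_subset _ _) fun _ _ _ => by positivity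
  rw [sum_norm_sq_expSum hA (by omega), Nat.cast_mul] at h1
  refine le_of_mul_le_mul_right ?_ hAr
  calc _ = (#R : ℝ) * ((#A : ℝ) ^ 2 * #B) := by ring
    _ ≤ _ := h1
    _ = _ := by
      push_cast
      ring

/-- If `|A||B|/N²` is bounded below in terms of `L`, and `N` is large in terms of `L`, then `A + B`
contains a translate of the set of values of the given polynomials at a nonzero integer. -/
theorem exists_translate_eval_subset_add {ℓ : ℕ} (hℓ : 1 ≤ ℓ) (k : ℕ) (P : Fin ℓ → Polynomial ℤ)
    (hP0 : ∀ i, (P i).eval 0 = 0) (hPdeg : ∀ i, (P i).natDegree ≤ k) :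
    ∃ E c : ℕ, ∀ (N L : ℕ) (A B : Finset ℤ), 1 ≤ N → A ⊆ Icc 1 (N : ℤ) → B ⊆ Icc 1 (N : ℤ) →
      A.Nonempty → B.Nonempty → 128 * (ℓ : ℝ) ^ 3 * N ^ 2 ≤ L * (#A * #B) →
      c * ((96 * ℓ * L) ^ (E * L ^ 2)) ^ k ≤ N →
      ∃ d : ℤ, d ≠ 0 ∧ ∃ m : ℤ, 2 ≤ m ∧ m ≤ 2 * N ∧ ∀ i, m + (P i).eval d ∈ A + B := by
  obtain ⟨E, hE⟩ := exists_polynomial_recurrence k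
  refine ⟨6 * E, ∑ i, coeffNorm k (P i), fun N L A B hN hA hB hA0 hB0 hL hNL => ?_⟩
  set R : Finset ℕ := {r ∈ range (4 * N) |
    (#A : ℝ) ^ 2 * #B ≤ 32 * ℓ ^ 2 * N * ‖expSum (4 * N) A r‖ ^ 2} with hR
  have hAr : (1 : ℝ) ≤ #A := by exact_mod_cast hA0.card_pos
  have hBr : (1 : ℝ) ≤ #B := by exact_mod_cast hB0.card_pos
  have hRne : 0 ∈ R := by
    rw [hR, mem_filter, mem_range]
    refine ⟨by omega, ?_⟩
    have h1 : expSum (4 * N) A 0 = #A := by simp [expSum, unitExp_zero]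
    have hBN : (#B : ℝ) ≤ N := by
      have := card_le_card hB
      rw [Int.card_Icc] at this
      exact_mod_cast (by omega : #B ≤ N)
    rw [h1, Complex.norm_natCast]
    have h2 : (1 : ℝ) ≤ ℓ ^ 2 := one_le_pow₀ (by exact_mod_cast hℓ)
    have h3 : (#B : ℝ) ≤ 32 * ℓ ^ 2 * N := by nlinarith
    calc (#A : ℝ) ^ 2 * #B ≤ (#A : ℝ) ^ 2 * (32 * ℓ ^ 2 * N) := by gcongr
      _ = _ := by ring
  have hR1 : 1 ≤ #R := card_pos.2 ⟨0, hRne⟩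
  have : Nonempty (Fin ℓ × R) := ⟨(⟨0, hℓ⟩, ⟨0, hRne⟩)⟩
  have hcard : Fintype.card (Fin ℓ × R) = ℓ * #R := by simp
  have hRL : ℓ * #R ≤ L := by
    have h1 := card_large_expSum_mul_le (ℓ := ℓ) (B := B) hN hA hA0
    rw [← hR] at h1
    have h2 : ((ℓ * #R : ℕ) : ℝ) * (#A * #B) ≤ L * (#A * #B) := by
      refine le_trans ?_ hL
      calc ((ℓ * #R : ℕ) : ℝ) * (#A * #B) = ℓ * (#R * (#A * #B)) := by
            push_cast
            ring
        _ ≤ ℓ * (128 * ℓ ^ 2 * N ^ 2) := by gcongr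
        _ = _ := by ring
    exact_mod_cast le_of_mul_le_mul_right h2 (by nlinarith)
  set K := ℓ * #R with hK
  have hK1 : 1 ≤ K := Nat.mul_pos hℓ hR1
  set M := 12 * ℓ * K with hM
  have hM1 : 1 ≤ M := Nat.mul_pos (by omega) hK1
  have hX : 8 * K * (K.factorial * M ^ K) ≤ (96 * ℓ * K) ^ (3 * K) := by
    have h1 : 8 * K ≤ (96 * ℓ * K) ^ K := by
      calc 8 * K ≤ 96 * ℓ * K := by gcongr; omega
        _ ≤ (96 * ℓ * K) ^ K := Nat.le_self_pow (by omega) _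
    have h2 : K.factorial ≤ (96 * ℓ * K) ^ K := by
      refine (Nat.factorial_le_pow K).trans (Nat.pow_le_pow_left ?_ _)
      exact Nat.le_mul_of_pos_left _ (by omega)
    have h3 : M ^ K ≤ (96 * ℓ * K) ^ K := by
      refine Nat.pow_le_pow_left ?_ _
      rw [hM]
      gcongr
      norm_num
    calc 8 * K * (K.factorial * M ^ K)
        ≤ (96 * ℓ * K) ^ K * ((96 * ℓ * K) ^ K * (96 * ℓ * K) ^ K) := by gcongr
      _ = _ := by ring
  obtain ⟨d, hd1, hdX, hd⟩ := hE (fun (j : Fin ℓ × R) s => (P j.1).coeff s * (j.2 : ℕ) / (4 * N : ℕ))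
    M ((96 * ℓ * K) ^ (3 * K)) (by
      intro j
      simp [Polynomial.coeff_zero_eq_eval_zero, hP0]) hM1 (by rw [hcard]; exact hX)
  rw [hcard] at hdX hd
  have hphase : ∀ j : Fin ℓ × R,
      polyPhase k (fun s => (P j.1).coeff s * (j.2 : ℕ) / (4 * N : ℕ)) d =
      ((P j.1).eval (d : ℤ) : ℤ) * (j.2 : ℕ) / (4 * N : ℕ) := by
    intro j
    rw [polyPhase, Polynomial.eval_eq_sum_range' (Nat.lt_succ_of_le (hPdeg j.1)), Int.cast_sum,
      sum_mul, sum_div]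
    refine sum_congr rfl fun s _ => ?_
    push_cast
    ring
  have hdL : d ≤ (96 * ℓ * L) ^ (6 * E * L ^ 2) := by
    have hL1 : 1 ≤ L := hK1.trans hRL
    refine hdX.trans ?_
    rw [← pow_mul]
    have h1 : 3 * K * (E * (K + 1)) ≤ 6 * E * L ^ 2 := by
      calc 3 * K * (E * (K + 1)) ≤ 3 * L * (E * (L + L)) := by gcongr
        _ = _ := by ring
    calc (96 * ℓ * K) ^ (3 * K * (E * (K + 1))) ≤ (96 * ℓ * L) ^ (3 * K * (E * (K + 1))) := by
          gcongr
      _ ≤ _ := Nat.pow_le_pow_right (Nat.mul_pos (by omega) hL1) h1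
  refine ⟨d, by omega, exists_translate_subset_add hℓ hN hA hB hA0 hB0 hR hM
    (fun i => (P i).eval (d : ℤ)) (fun i => ?_) ?_⟩
  · refine (abs_eval_le (hPdeg i) hd1).trans ?_
    refine Nat.cast_le.2 (le_trans ?_ hNL)
    exact Nat.mul_le_mul (single_le_sum (f := fun i => coeffNorm k (P i)) (fun _ _ => Nat.zero_le _)
      (mem_univ i)) (Nat.pow_le_pow_left hdL k)
  · refine le_trans (le_of_eq ?_) hd
    rw [Fintype.sum_prod_type]
    refine sum_congr rfl fun i _ => ?_
    rw [← sum_coe_sort R]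
    refine sum_congr rfl fun r _ => ?_
    rw [hphase]

lemma one_lt_log_of_three_le {N : ℕ} (hN : 3 ≤ N) : 1 < Real.log N := by
  have hN' : (3 : ℝ) ≤ N := by exact_mod_cast hN
  rw [Real.lt_log_iff_exp_lt (by linarith)]
  linarith [Real.exp_one_lt_d9]

lemma one_le_log_log {N : ℕ} (hN : 16 ≤ N) : 1 ≤ Real.log (Real.log N) := by
  have hN' : (16 : ℝ) ≤ N := by exact_mod_cast hN
  have h1 : Real.log 16 ≤ Real.log N := Real.log_le_log (by norm_num) hN'
  have h2 : Real.log 16 = 4 * Real.log 2 := by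
    rw [show (16 : ℝ) = 2 ^ 4 by norm_num, Real.log_pow]
    norm_num
  have h3 := Real.log_two_gt_d9
  rw [Real.le_log_iff_exp_le (by linarith)]
  linarith [Real.exp_one_lt_d9]

lemma log_log_div_log_pos {N : ℕ} (hN : 3 ≤ N) : 0 < Real.log (Real.log N) / Real.log N := by
  have h := one_lt_log_of_three_le hN
  exact div_pos (Real.log_pos h) (by linarith)

lemma log_log_div_log_le_one {N : ℕ} (hN : 3 ≤ N) : Real.log (Real.log N) / Real.log N ≤ 1 := by
  have h := one_lt_log_of_three_le hN
  rw [div_le_one (by linarith)]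
  linarith [Real.log_le_sub_one_of_pos (by linarith : 0 < Real.log N)]

/-- Choice of the parameter `L` in terms of the density `δ`. -/
lemma exists_parameter {ℓ : ℕ} (hℓ : 1 ≤ ℓ) (k E c : ℕ) : ∃ T : ℝ, 0 < T ∧ ∃ N₀ : ℕ,
    ∀ N : ℕ, N₀ ≤ N → ∀ δ : ℝ, T * √(Real.log (Real.log N) / Real.log N) ≤ δ → δ ≤ 1 →
    ∃ L : ℕ, 128 * (ℓ : ℝ) ^ 3 ≤ L * δ ∧ c * ((96 * ℓ * L) ^ (E * L ^ 2)) ^ k ≤ N := by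
  have hℓr : (1 : ℝ) ≤ ℓ := by exact_mod_cast hℓ
  have hℓ3 : (1 : ℝ) ≤ (ℓ : ℝ) ^ 3 := one_le_pow₀ hℓr
  set W : ℝ := 2 * (E * k * (96 * ℓ)) + 1 with hW
  have hW1 : 1 ≤ W := by
    have : (0 : ℝ) ≤ E * k * (96 * ℓ) := by positivity
    linarith
  refine ⟨129 * ℓ ^ 3 * W, by positivity, max 16 (c ^ 2), fun N hN δ hδ hδ1 => ?_⟩
  have hN16 : 16 ≤ N := (le_max_left _ _).trans hN
  have hNc : c ^ 2 ≤ N := (le_max_right _ _).trans hN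
  have hlog := one_lt_log_of_three_le (by omega : 3 ≤ N)
  have hll := one_le_log_log hN16
  have hu := log_log_div_log_pos (by omega : 3 ≤ N)
  set x := Real.log N with hx
  set y := Real.log x with hy
  have hs : 0 < √(y / x) := Real.sqrt_pos.2 hu
  have hδ0 : 0 < δ := lt_of_lt_of_le (by positivity) hδ
  set L := ⌈128 * (ℓ : ℝ) ^ 3 / δ⌉₊ with hLdef
  have hL1 : 128 * (ℓ : ℝ) ^ 3 / δ ≤ L := Nat.le_ceil _
  have hL2 : (L : ℝ) < 128 * (ℓ : ℝ) ^ 3 / δ + 1 := Nat.ceil_lt_add_one (by positivity)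
  have hLpos : 0 < (L : ℝ) := lt_of_lt_of_le (by positivity) hL1
  have hLone : (1 : ℝ) ≤ L := by exact_mod_cast Nat.cast_pos.1 hLpos
  refine ⟨L, by rwa [div_le_iff₀ hδ0] at hL1, ?_⟩
  have hL3 : L * δ ≤ 129 * ℓ ^ 3 := by
    have h1 : L * δ < (128 * (ℓ : ℝ) ^ 3 / δ + 1) * δ := by gcongr
    rw [add_mul, div_mul_cancel₀ _ hδ0.ne'] at h1
    linarith
  have hL4 : L * W * √(y / x) ≤ 1 := by
    have h1 : 129 * (ℓ : ℝ) ^ 3 * (L * W * √(y / x)) ≤ 129 * (ℓ : ℝ) ^ 3 * 1 := by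
      calc 129 * (ℓ : ℝ) ^ 3 * (L * W * √(y / x)) = L * (129 * ℓ ^ 3 * W * √(y / x)) := by ring
        _ ≤ L * δ := by gcongr
        _ ≤ _ := by linarith
    exact le_of_mul_le_mul_left h1 (by linarith)
  have hL5 : L ^ 2 * W ^ 2 * y ≤ x := by
    have h1 : (L * W * √(y / x)) ^ 2 ≤ 1 := pow_le_one₀ (by positivity) hL4
    rw [mul_pow, Real.sq_sqrt hu.le, mul_pow, ← mul_div_assoc, div_le_one (by linarith)] at h1
    exact h1
  have hL6 : (L : ℝ) ^ 2 * W * y ≤ x := by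
    refine le_trans ?_ hL5
    have : W ≤ W ^ 2 := by nlinarith
    gcongr
  have hLx : (L : ℝ) ≤ x := by
    refine le_trans ?_ hL6
    calc (L : ℝ) ≤ L ^ 2 := by nlinarith
      _ = L ^ 2 * 1 * 1 := by ring
      _ ≤ _ := by gcongr
  have hlogL : Real.log (96 * ℓ * L) ≤ 96 * ℓ * y := by
    rw [Real.log_mul (by positivity) (by positivity)]
    have h1 := Real.log_le_sub_one_of_pos (by positivity : (0 : ℝ) < 96 * ℓ)
    have h2 : Real.log L ≤ y := Real.log_le_log hLpos hLx
    nlinarith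
  set X := ((96 * ℓ * L) ^ (E * L ^ 2)) ^ k with hX
  have hXr : (X : ℝ) = (96 * ℓ * L) ^ (E * L ^ 2 * k) := by
    rw [hX, ← pow_mul]
    push_cast
    rfl
  have hX2 : X ^ 2 ≤ N := by
    have hX0 : (0 : ℝ) < X := by
      rw [hXr]
      positivity
    have h1 : Real.log ((X : ℝ) ^ 2) ≤ x := by
      rw [Real.log_pow, hXr, Real.log_pow]
      push_cast
      calc 2 * (E * (L : ℝ) ^ 2 * k * Real.log (96 * ℓ * L))
          ≤ 2 * (E * (L : ℝ) ^ 2 * k * (96 * ℓ * y)) := by gcongr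
        _ = L ^ 2 * (2 * (E * k * (96 * ℓ))) * y := by ring
        _ ≤ L ^ 2 * W * y := by
          gcongr
          linarith
        _ ≤ x := hL6
    have h2 := (Real.log_le_log_iff (by positivity) (by positivity)).1 h1
    exact_mod_cast h2
  have h3 : (c * X) ^ 2 ≤ N ^ 2 := by
    rw [mul_pow, sq N]
    exact Nat.mul_le_mul hNc hX2
  exact (Nat.pow_le_pow_iff_left (by norm_num)).1 h3

/-- A single shift, one polynomial at one point: a set `A` with more than `|t|` elements suffices. -/
lemma exists_add_mem_add {N : ℕ} {A B : Finset ℤ} (hA : A ⊆ Icc 1 (N : ℤ)) (hB : B ⊆ Icc 1 (N : ℤ))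
    (hB0 : B.Nonempty) {t : ℤ} (ht : |t| < #A) : ∃ m : ℤ, 2 ≤ m ∧ m ≤ 2 * N ∧ m + t ∈ A + B := by
  obtain ⟨b, hb⟩ := hB0
  have hb' := mem_Icc.1 (hB hb)
  have key : ∃ a ∈ A, 1 + t ≤ a ∧ a ≤ N + t := by
    by_contra h
    push Not at h
    rcases le_total 0 t with h0 | h0
    · have h1 : A ⊆ Icc 1 t := by
        intro a ha
        have h2 := mem_Icc.1 (hA ha)
        have h3 := h a ha
        rw [mem_Icc]
        omega
      have h4 := card_le_card h1
      rw [Int.card_Icc] at h4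
      rw [abs_of_nonneg h0] at ht
      omega
    · have h1 : A ⊆ Icc (N + t + 1) N := by
        intro a ha
        have h2 := mem_Icc.1 (hA ha)
        have h3 := h a ha
        rw [mem_Icc]
        omega
      have h4 := card_le_card h1
      rw [Int.card_Icc] at h4
      rw [abs_of_nonpos h0] at ht
      omega
  obtain ⟨a, ha, h1, h2⟩ := key
  refine ⟨a + b - t, by omega, by omega, ?_⟩
  rw [sub_add_cancel]
  exact add_mem_add ha hb

lemma sqrt_le_rpow_one_div {u : ℝ} (hu : 0 < u) (hu1 : u ≤ 1) {n : ℕ} (hn : 2 ≤ n) :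
    √u ≤ u ^ ((1 : ℝ) / n) := by
  rw [Real.sqrt_eq_rpow]
  refine Real.rpow_le_rpow_of_exponent_ge hu hu1 ?_
  have : (2 : ℝ) ≤ n := by exact_mod_cast hn
  gcongr

lemma card_mul_card_div_sq_le_one {N : ℕ} (hN : 1 ≤ N) {A B : Finset ℤ} (hA : A ⊆ Icc 1 (N : ℤ))
    (hB : B ⊆ Icc 1 (N : ℤ)) : (#A : ℝ) * #B / (N : ℝ) ^ 2 ≤ 1 := by
  have hA' : (#A : ℝ) ≤ N := by
    have := card_le_card hA
    rw [Int.card_Icc] at this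
    exact_mod_cast (by omega : #A ≤ N)
  have hB' : (#B : ℝ) ≤ N := by
    have := card_le_card hB
    rw [Int.card_Icc] at this
    exact_mod_cast (by omega : #B ≤ N)
  rw [div_le_one (by positivity), sq]
  gcongr

/-- **Corollary (Lyall–Magyar).** If `A, B ⊆ [1,N]` and for every nonzero `d` and every
`m ∈ [2,2N]` the translate `m + {P₁(d),…,P_ℓ(d)}` is not contained in the sumset `A + B`,
then `|A||B|/N² ≤ C' (log log N / log N)^(1/(ℓ(k-1)))`. -/
theorem stmt_1 (ℓ k : ℕ) (hk : 2 ≤ k) (hℓ : 1 ≤ ℓ)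
    (P : Fin ℓ → Polynomial ℤ)
    (hP0 : ∀ i, (P i).eval 0 = 0)
    (hPdeg : ∀ i, (P i).natDegree ≤ k)
    (hPmax : ∃ i, (P i).natDegree = k) :
    ∃ C' : ℝ, 0 < C' ∧ ∀ N : ℕ, 3 ≤ N → ∀ A B : Finset ℤ,
      A ⊆ Finset.Icc 1 (N : ℤ) → B ⊆ Finset.Icc 1 (N : ℤ) →
      (∀ d : ℤ, d ≠ 0 → ∀ m : ℤ, 2 ≤ m → m ≤ 2 * N →
        ∃ i : Fin ℓ, m + (P i).eval d ∉ A + B) →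
      (A.card : ℝ) * B.card / (N : ℝ) ^ 2 ≤
        C' * (Real.log (Real.log N) / Real.log N) ^ ((1 : ℝ) / ((ℓ * (k - 1) : ℕ) : ℝ)) := by
  set u : ℕ → ℝ := fun N => Real.log (Real.log N) / Real.log N with hu
  have hu0 : ∀ N, 3 ≤ N → 0 < u N := fun N hN => log_log_div_log_pos hN
  have hu1 : ∀ N, 3 ≤ N → u N ≤ 1 := fun N hN => log_log_div_log_le_one hN
  rcases hℓ.eq_or_lt with rfl | hℓ2
  · set t := (P 0).eval 1 with ht
    have hl3 : 0 < Real.log (Real.log 3) := by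
      have := one_lt_log_of_three_le le_rfl
      exact Real.log_pos (by exact_mod_cast this)
    refine ⟨(|t| + 1 : ℤ) / Real.log (Real.log 3), div_pos (by positivity) hl3,
      fun N hN A B hA hB h => ?_⟩
    have hlog := one_lt_log_of_three_le hN
    have hNr : (3 : ℝ) ≤ N := by exact_mod_cast hN
    have hue : u N ≤ u N ^ ((1 : ℝ) / ((1 * (k - 1) : ℕ) : ℝ)) := by
      nth_rewrite 1 [← Real.rpow_one (u N)]
      refine Real.rpow_le_rpow_of_exponent_ge (hu0 N hN) (hu1 N hN) ?_
      have : (1 : ℝ) ≤ ((1 * (k - 1) : ℕ) : ℝ) := by exact_mod_cast (by omega)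
      exact (div_le_one (by linarith)).2 this
    refine le_trans ?_ (mul_le_mul_of_nonneg_left hue (by positivity))
    have hsmall : (#A : ℝ) * #B ≤ (|t| + 1 : ℤ) * N := by
      rcases B.eq_empty_or_nonempty with rfl | hB0
      · simp only [card_empty, Nat.cast_zero, mul_zero]
        positivity
      have h1 : ¬ |t| < #A := by
        intro hlt
        obtain ⟨m, hm2, hmN, hm⟩ := exists_add_mem_add hA hB hB0 hlt
        obtain ⟨i, hi⟩ := h 1 one_ne_zero m hm2 hmN
        rw [Subsingleton.elim i 0] at hi
        exact hi hm
      have h2 : #B ≤ N := by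
        have := card_le_card hB
        rw [Int.card_Icc] at this
        omega
      have h3 : (#A : ℝ) ≤ (|t| + 1 : ℤ) := by exact_mod_cast (by omega : (#A : ℤ) ≤ |t| + 1)
      gcongr
    have hcmp : 1 / (N : ℝ) ≤ u N / Real.log (Real.log 3) := by
      rw [hu]
      dsimp only
      have h1 : Real.log (Real.log 3) ≤ Real.log (Real.log N) := by
        refine Real.log_le_log ?_ (Real.log_le_log (by norm_num) hNr)
        exact Real.log_pos (by norm_num)
      have h2 : Real.log N ≤ N := by
        linarith [Real.log_le_sub_one_of_pos (by linarith : (0 : ℝ) < N)]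
      rw [div_div, div_le_div_iff₀ (by linarith) (by positivity), one_mul]
      nlinarith
    calc (#A : ℝ) * #B / (N : ℝ) ^ 2 ≤ (|t| + 1 : ℤ) * N / (N : ℝ) ^ 2 := by gcongr
      _ = (|t| + 1 : ℤ) * (1 / (N : ℝ)) := by
        field_simp
      _ ≤ (|t| + 1 : ℤ) * (u N / Real.log (Real.log 3)) := by gcongr
      _ = _ := by ring
  · obtain ⟨E, c, hEc⟩ := exists_translate_eval_subset_add hℓ k P hP0 hPdeg
    obtain ⟨T, hT, N₀, hN₀⟩ := exists_parameter hℓ k E c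
    have hn : 2 ≤ ℓ * (k - 1) := by
      calc 2 = 2 * 1 := rfl
        _ ≤ _ := Nat.mul_le_mul hℓ2 (by omega)
    set e : ℝ := (1 : ℝ) / ((ℓ * (k - 1) : ℕ) : ℝ) with he
    set S : ℝ := ∑ n ∈ Ico 3 N₀, (u n ^ e)⁻¹ with hS
    have hupos : ∀ n, 3 ≤ n → 0 < u n ^ e := fun n hn => Real.rpow_pos_of_pos (hu0 n hn) _
    have hSterm : ∀ n ∈ Ico 3 N₀, 0 ≤ (u n ^ e)⁻¹ := fun n hn =>
      inv_nonneg.2 (hupos n (mem_Ico.1 hn).1).le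
    have hS0 : 0 ≤ S := sum_nonneg hSterm
    refine ⟨T + S, by linarith, fun N hN A B hA hB h => ?_⟩
    have hup := hupos N hN
    have hδ1 := card_mul_card_div_sq_le_one (by omega : 1 ≤ N) hA hB
    change _ ≤ (T + S) * u N ^ e
    rcases lt_or_ge N N₀ with hlt | hge
    · have h1 : (u N ^ e)⁻¹ ≤ S := single_le_sum hSterm (mem_Ico.2 ⟨hN, hlt⟩)
      calc (#A : ℝ) * #B / (N : ℝ) ^ 2 ≤ 1 := hδ1
        _ = (u N ^ e)⁻¹ * u N ^ e := (inv_mul_cancel₀ hup.ne').symm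
        _ ≤ (T + S) * u N ^ e := by
          gcongr
          linarith
    · by_contra hcon
      push Not at hcon
      have h1 : T * √(u N) ≤ #A * #B / (N : ℝ) ^ 2 := by
        refine le_trans ?_ hcon.le
        have := sqrt_le_rpow_one_div (hu0 N hN) (hu1 N hN) hn
        rw [← he] at this
        gcongr
        linarith
      obtain ⟨L, hL, hLN⟩ := hN₀ N hge _ h1 hδ1
      have hδ0 : (0 : ℝ) < #A * #B / (N : ℝ) ^ 2 :=
        lt_of_le_of_lt (by positivity) hcon
      have hAB : A.Nonempty ∧ B.Nonempty := by
        constructor <;> rw [nonempty_iff_ne_empty] <;> rintro rfl <;> simp at hδ0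
      have hNr : (0 : ℝ) < (N : ℝ) ^ 2 := by positivity
      obtain ⟨d, hd, m, hm2, hmN, hm⟩ := hEc N L A B (by omega) hA hB hAB.1 hAB.2 (by
        rwa [← mul_div_assoc, le_div_iff₀ hNr] at hL) hLN
      obtain ⟨i, hi⟩ := h d hd m hm2 hmN
      exact hi (hm i)
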